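/- Hook decomposition of the Hecke algebra image: the K-dimension of the subalgebra 𝒜_q of End_K(V^{⊗r}) generated by the Hecke operators T_1, …, T_{r−1} equals Σ_{λ ∈ H(m,n;r)} (f^λ)², the sum over partitions λ of r contained in the (m,n)-hook of the squares of the numbers of standard Young tableaux of shape λ. -/

import Mathlib

set_option synthInstance.maxHeartbeats 1000000
set_option maxHeartbeats 1000000

open scoped BigOperators Kronecker

section CommonDefs

variable {R : Type*} [CommRing R]

/-- ℤ₂-degree of the basis vector `v_{k+1}` (0-based index `k`): `0` if `k < m`, else `1`. -/
def deg (m : ℕ) {N : ℕ} (k : Fin N) : ℕ := if (k : ℕ) < m then 0 else 1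

/-- The sign `(−1)^{|v_k||v_l|}`. -/
def sgn (R : Type*) [CommRing R] (m : ℕ) {N : ℕ} (k l : Fin N) : R :=
  (-1 : R) ^ (deg m k * deg m l)

/-- Entries (row = input vector) of the operator `T` on `V ⊗ V`, where `x` plays the
role of `q` and `xinv` that of `q⁻¹`:  `T(v_k ⊗ v_k) = q·v_k ⊗ v_k` if `k ≤ m`,
`T(v_k ⊗ v_k) = −q⁻¹·v_k ⊗ v_k` if `k > m`,
`T(v_k ⊗ v_l) = (−1)^{|v_k||v_l|} v_l ⊗ v_k + (q−q⁻¹) v_k ⊗ v_l` if `k < l`, and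
`T(v_k ⊗ v_l) = (−1)^{|v_k||v_l|} v_l ⊗ v_k` if `k > l`. -/
def Tent (x xinv : R) (m : ℕ) {N : ℕ} (p p' : Fin N × Fin N) : R :=
  if p.1 = p.2 then (if (p.1 : ℕ) < m then x else -xinv) * (if p' = p then 1 else 0)
  else if (p.1 : ℕ) < (p.2 : ℕ) then
    sgn R m p.1 p.2 * (if p' = (p.2, p.1) then 1 else 0)
      + (x - xinv) * (if p' = p then 1 else 0)
  else sgn R m p.1 p.2 * (if p' = (p.2, p.1) then 1 else 0)

/-- Entries of the signed swap `P(v_k ⊗ v_l) = (−1)^{|v_k||v_l|} v_l ⊗ v_k`. -/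
def Pent (R : Type*) [CommRing R] (m : ℕ) {N : ℕ} (p p' : Fin N × Fin N) : R :=
  sgn R m p.1 p.2 * (if p' = (p.2, p.1) then 1 else 0)

/-- The operator `Id^{⊗ i} ⊗ E ⊗ Id^{⊗ (r−i−2)}` on `V^{⊗ r}` obtained from a two-site
operator `E` acting on the (0-based) tensor positions `i` and `i+1`. -/
def twoSiteOp {N : ℕ} (E : Fin N × Fin N → Fin N × Fin N → R) (r i : ℕ) (h : i + 1 < r) :
    Matrix (Fin r → Fin N) (Fin r → Fin N) R := fun a b =>
  E (a ⟨i, Nat.lt_of_succ_lt h⟩, a ⟨i + 1, h⟩) (b ⟨i, Nat.lt_of_succ_lt h⟩, b ⟨i + 1, h⟩) *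
    ∏ j ∈ Finset.univ \ ({⟨i, Nat.lt_of_succ_lt h⟩, ⟨i + 1, h⟩} : Finset (Fin r)),
      (if a j = b j then (1 : R) else 0)

/-- The Hecke operator `T_{i+1} = Id^{⊗ i} ⊗ T ⊗ Id^{⊗ (r−i−2)}` on `V^{⊗ r}`
(here `i` is the 0-based position of the first tensor factor it acts on). -/
def heckeOp (x xinv : R) (m : ℕ) {N : ℕ} (r i : ℕ) (h : i + 1 < r) :
    Matrix (Fin r → Fin N) (Fin r → Fin N) R :=
  twoSiteOp (Tent x xinv m) r i h

/-- The signed swap operator `P_{i+1} = Id^{⊗ i} ⊗ P ⊗ Id^{⊗ (r−i−2)}` on `V^{⊗ r}`. -/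
def swapOp (R : Type*) [CommRing R] (m : ℕ) {N : ℕ} (r i : ℕ) (h : i + 1 < r) :
    Matrix (Fin r → Fin N) (Fin r → Fin N) R :=
  twoSiteOp (Pent R m) r i h

/-- The parity operator `S v_j = (−1)^{|v_j|} v_j`. -/
def Smat (R : Type*) [CommRing R] (m : ℕ) {N : ℕ} : Matrix (Fin N) (Fin N) R :=
  fun a b => if a = b then (-1 : R) ^ deg m a else 0

/-- The diagonal operator `Q_b v_j = q^{δ_{bj}} v_j` (`x` playing the role of `q`, or of
`q⁻¹` for the inverse operator). -/
def Qmat (x : R) {N : ℕ} (b0 : Fin N) : Matrix (Fin N) (Fin N) R :=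
  fun a b => if a = b then (if a = b0 then x else 1) else 0

/-- `E_k v_{k+1} = v_k`, `E_k v_j = 0` otherwise (0-based `k`; row = input). -/
def Emat (R : Type*) [CommRing R] {N : ℕ} (k : ℕ) : Matrix (Fin N) (Fin N) R :=
  fun a b => if (a : ℕ) = k + 1 ∧ (b : ℕ) = k then 1 else 0

/-- `F_k v_k = v_{k+1}`, `F_k v_j = 0` otherwise (0-based `k`; row = input). -/
def Fmat (R : Type*) [CommRing R] {N : ℕ} (k : ℕ) : Matrix (Fin N) (Fin N) R :=
  fun a b => if (a : ℕ) = k ∧ (b : ℕ) = k + 1 then 1 else 0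

/-- The diagonal operator `D_k v_j = q^{s(k)δ_{kj} − s(k+1)δ_{k+1,j}} v_j`
(0-based `k`, so `s(k) = 1` iff `k < m`, and `s(k) = −1` otherwise). -/
def Dmat (x xinv : R) (m : ℕ) {N : ℕ} (k : ℕ) : Matrix (Fin N) (Fin N) R :=
  fun a b => if a = b then
    (if (a : ℕ) = k then (if k < m then x else xinv)
     else if (a : ℕ) = k + 1 then (if k + 1 < m then xinv else x) else 1)
  else 0

/-- The inverse `D_k⁻¹` of `Dmat` (obtained by exchanging `q` and `q⁻¹`). -/
def Dinvmat (x xinv : R) (m : ℕ) {N : ℕ} (k : ℕ) : Matrix (Fin N) (Fin N) R :=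
  Dmat xinv x m k

/-- `S^{p(k)}`, where `p(k) = 1` if the 0-based `k` satisfies `k + 1 = m` (the odd simple
root) and `p(k) = 0` otherwise. -/
def SPmat (R : Type*) [CommRing R] (m : ℕ) {N : ℕ} (k : ℕ) : Matrix (Fin N) (Fin N) R :=
  if k + 1 = m then Smat R m else 1

/-- Kronecker (tensor) product of `r` one-site operators, as a matrix on `V^{⊗ r}`. -/
def kron {N r : ℕ} (M : Fin r → Matrix (Fin N) (Fin N) R) :
    Matrix (Fin r → Fin N) (Fin r → Fin N) R :=
  fun a b => ∏ j, M j (a j) (b j)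

/-- `ρ_r(σ) = S^{⊗ r}`. -/
def rhoSigma (R : Type*) [CommRing R] (m : ℕ) {N : ℕ} (r : ℕ) :
    Matrix (Fin r → Fin N) (Fin r → Fin N) R :=
  kron fun _ => Smat R m

/-- `ρ_r(q^{δ_b}) = Q_b^{⊗ r}` (and its inverse, substituting `q⁻¹` for `x`). -/
def rhoQ (x : R) {N : ℕ} (r : ℕ) (b0 : Fin N) :
    Matrix (Fin r → Fin N) (Fin r → Fin N) R :=
  kron fun _ => Qmat x b0

/-- `ρ_r(e_k) = Σ_{j=1}^{r} (S^{p(k)})^{⊗(j−1)} ⊗ E_k ⊗ (D_k^{−1})^{⊗(r−j)}`. -/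
def rhoE (x xinv : R) (m : ℕ) {N : ℕ} (r : ℕ) (k : ℕ) :
    Matrix (Fin r → Fin N) (Fin r → Fin N) R :=
  ∑ p : Fin r, kron fun j =>
    if j < p then SPmat R m k else if j = p then Emat R k else Dinvmat x xinv m k

/-- `ρ_r(f_k) = Σ_{j=1}^{r} (S^{p(k)}D_k)^{⊗(j−1)} ⊗ F_k ⊗ Id^{⊗(r−j)}`. -/
def rhoF (x xinv : R) (m : ℕ) {N : ℕ} (r : ℕ) (k : ℕ) :
    Matrix (Fin r → Fin N) (Fin r → Fin N) R :=
  ∑ p : Fin r, kron fun j =>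
    if j < p then SPmat R m k * Dmat x xinv m k else if j = p then Fmat R k else 1

/-- The generators `T_1, …, T_{r−1}` of the image of the sign `q`-permutation
representation of the Iwahori–Hecke algebra on `V^{⊗ r}`. -/
def heckeGens (x xinv : R) (m : ℕ) {N : ℕ} (r : ℕ) :
    Set (Matrix (Fin r → Fin N) (Fin r → Fin N) R) :=
  {M | ∃ (i : ℕ) (h : i + 1 < r), M = heckeOp x xinv m r i h}

/-- The signed-swap generators `P_1, …, P_{r−1}` (the `q → 1` specialization). -/
def swapGens (R : Type*) [CommRing R] (m : ℕ) {N : ℕ} (r : ℕ) :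
    Set (Matrix (Fin r → Fin N) (Fin r → Fin N) R) :=
  {M | ∃ (i : ℕ) (h : i + 1 < r), M = swapOp R m r i h}

/-- The generators `ρ_r(σ)`, `ρ_r(q^{± δ_b})` (`1 ≤ b ≤ N`), `ρ_r(e_k)`, `ρ_r(f_k)`
(`1 ≤ k ≤ N−1`) of the image of the vector representation of `U_q^σ(gl(m,n))`. -/
def quantumGens (x xinv : R) (m : ℕ) {N : ℕ} (r : ℕ) :
    Set (Matrix (Fin r → Fin N) (Fin r → Fin N) R) :=
  {rhoSigma R m r} ∪ (Set.range fun b : Fin N => rhoQ x r b)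
    ∪ (Set.range fun b : Fin N => rhoQ xinv r b)
    ∪ (Set.range fun k : Fin (N - 1) => rhoE x xinv m r (k : ℕ))
    ∪ (Set.range fun k : Fin (N - 1) => rhoF x xinv m r (k : ℕ))

end CommonDefs

/-- The base field `K = ℚ(q)` of rational functions over `ℚ`. -/
abbrev 𝕂 : Type := RatFunc ℚ

/-- The indeterminate `q` of `K = ℚ(q)`. -/
noncomputable def q : 𝕂 := RatFunc.X

/-- Cell membership in the Young diagram of a partition `lam` of `r`: the (0-based) cell
`(i, j)` lies in the diagram iff more than `i` parts of `lam` exceed `j`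
(equivalently, `j < λ_{i+1}`). -/
def cellIn {r : ℕ} (lam : Nat.Partition r) (c : ℕ × ℕ) : Prop :=
  c.1 < (lam.parts.filter fun p => c.2 < p).card

/-- `f^λ`: the number of standard Young tableaux of shape `lam`, i.e. bijective fillings
of the cells of the Young diagram of `lam` by `1, …, r` that strictly increase along
each row and down each column. -/
noncomputable def fSYT {r : ℕ} (lam : Nat.Partition r) : ℕ :=
  Nat.card {f : {c : ℕ × ℕ // cellIn lam c} → Fin r //
    Function.Bijective f ∧
      (∀ c d : {c : ℕ × ℕ // cellIn lam c}, c.1.1 = d.1.1 → c.1.2 < d.1.2 → f c < f d) ∧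
      (∀ c d : {c : ℕ × ℕ // cellIn lam c}, c.1.2 = d.1.2 → c.1.1 < d.1.1 → f c < f d)}

/-- The `(m,n)`-hook `H(m,n;r)`: partitions `λ = (λ_1 ≥ λ_2 ≥ …)` of `r` with
`λ_j ≤ n` for all `j > m`, i.e. at most `m` parts exceed `n`. -/
def hookFinset (m n r : ℕ) : Finset (Nat.Partition r) :=
  Finset.univ.filter fun lam => (lam.parts.filter fun p => n < p).card ≤ m

/-- `𝒜_q`: the `K`-subalgebra of `End_K(V^{⊗ r})` generated by the Hecke operators
`T_1, …, T_{r−1}`. -/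
noncomputable def Aq (m n r : ℕ) :
    Subalgebra 𝕂 (Module.End 𝕂 ((Fin r → Fin (m + n)) → 𝕂)) :=
  Algebra.adjoin 𝕂 (Matrix.vecMulLinear '' heckeGens q q⁻¹ m (N := m + n) r)

namespace HeckeHook

section Local

variable {K I Y : Type*} [Field K] [DecidableEq I]

/-- The operator on words `I → Y` which sends a word `a` to
`α (a p) (a p') • a + β (a p) (a p') • a'`, where `a'` is `a` with the letters at `p` and `p'`
exchanged. -/
noncomputable def localOp (α β : Y → Y → K) (p p' : I) :
    ((I → Y) →₀ K) →ₗ[K] ((I → Y) →₀ K) :=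
  Finsupp.linearCombination K fun a =>
    α (a p) (a p') • Finsupp.single a 1 +
      β (a p) (a p') • Finsupp.single (a ∘ Equiv.swap p p') 1

/-- The local form of the quadratic relation `T² = z T + 1`. -/
def QuadAt (z : K) (α β : Y → Y → K) (a b : Y) : Prop :=
  α a b ^ 2 + β a b * β b a = z * α a b + 1 ∧ β a b * (α a b + α b a - z) = 0

/-- The local form of the braid relation. -/
def BraidAt (α β : Y → Y → K) (a b c : Y) : Prop :=
  α a b ^ 2 * α b c + β a b * β b a * α a c = α b c ^ 2 * α a b + β b c * β c b * α a c ∧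
  β a b * (α a b * α b c + α a c * α b a - α b c * α a c) = 0 ∧
  β b c * (α b c * α a b + α a c * α c b - α a b * α a c) = 0

variable {α β : Y → Y → K}

lemma localOp_single (p p' : I) (a : I → Y) :
    localOp α β p p' (Finsupp.single a 1) = α (a p) (a p') • Finsupp.single a 1 +
      β (a p) (a p') • Finsupp.single (a ∘ Equiv.swap p p') 1 := by
  simp [localOp]

lemma localOp_quad {z : K} {p p' : I} {a : I → Y} (h : QuadAt z α β (a p) (a p')) :
    localOp α β p p' (localOp α β p p' (Finsupp.single a 1)) =
      z • localOp α β p p' (Finsupp.single a 1) + Finsupp.single a 1 := by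
  obtain ⟨h1, h2⟩ := h
  have e : (a ∘ Equiv.swap p p') ∘ Equiv.swap p p' = a := by
    funext x; simp
  simp only [localOp_single, map_add, map_smul, Function.comp_apply, Equiv.swap_apply_left,
    Equiv.swap_apply_right, e]
  generalize (Finsupp.single a 1 : (I → Y) →₀ K) = v at *
  generalize (Finsupp.single (a ∘ Equiv.swap p p') 1 : (I → Y) →₀ K) = w at *
  linear_combination (norm := module) h1 • v + h2 • w

lemma localOp_comm {p p' s s' : I} (h1 : p ≠ s) (h2 : p ≠ s') (h3 : p' ≠ s) (h4 : p' ≠ s')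
    (a : I → Y) :
    localOp α β p p' (localOp α β s s' (Finsupp.single a 1)) =
      localOp α β s s' (localOp α β p p' (Finsupp.single a 1)) := by
  have e : (a ∘ Equiv.swap s s') ∘ Equiv.swap p p' = (a ∘ Equiv.swap p p') ∘ Equiv.swap s s' := by
    funext x
    simp only [Function.comp_apply, Equiv.swap_apply_def]
    grind
  simp only [localOp_single, map_add, map_smul, Function.comp_apply, e,
    Equiv.swap_apply_of_ne_of_ne h1 h2, Equiv.swap_apply_of_ne_of_ne h3 h4,
    Equiv.swap_apply_of_ne_of_ne h1.symm h3.symm, Equiv.swap_apply_of_ne_of_ne h2.symm h4.symm]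
  module

lemma localOp_braid {p p' p'' : I} (h1 : p ≠ p') (h2 : p' ≠ p'') (h3 : p ≠ p'')
    {a : I → Y} (h : BraidAt α β (a p) (a p') (a p'')) :
    localOp α β p p' (localOp α β p' p'' (localOp α β p p' (Finsupp.single a 1))) =
      localOp α β p' p'' (localOp α β p p' (localOp α β p' p'' (Finsupp.single a 1))) := by
  obtain ⟨b1, b2, b3⟩ := h
  have e1 : (a ∘ Equiv.swap p p') ∘ Equiv.swap p p' = a := by funext x; simp
  have e2 : (a ∘ Equiv.swap p' p'') ∘ Equiv.swap p' p'' = a := by funext x; simp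
  have e3 : ((a ∘ Equiv.swap p p') ∘ Equiv.swap p' p'') ∘ Equiv.swap p p' =
      ((a ∘ Equiv.swap p' p'') ∘ Equiv.swap p p') ∘ Equiv.swap p' p'' := by
    funext x
    simp only [Function.comp_apply, Equiv.swap_apply_def]
    grind
  simp only [localOp_single, map_add, map_smul, Function.comp_apply, Equiv.swap_apply_left,
    Equiv.swap_apply_right, e1, e2, e3, Equiv.swap_apply_of_ne_of_ne h1 h3,
    Equiv.swap_apply_of_ne_of_ne h3.symm h2.symm]
  generalize (Finsupp.single a 1 : (I → Y) →₀ K) = v1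
  generalize (Finsupp.single (a ∘ Equiv.swap p p') 1 : (I → Y) →₀ K) = v2
  generalize (Finsupp.single (a ∘ Equiv.swap p' p'') 1 : (I → Y) →₀ K) = v3
  linear_combination (norm := module) b1 • v1 + b2 • v2 - b3 • v3

end Local

/-- The defining relations of the Iwahori–Hecke algebra, for the elements `T 0, …, T (n - 1)`. -/
structure HeckeRel {K E : Type*} [Field K] [Ring E] [Algebra K E] (z : K) (n : ℕ) (T : ℕ → E) :
    Prop where
  quad : ∀ i < n, T i * T i = z • T i + 1
  comm : ∀ i j, i + 1 < j → j < n → T i * T j = T j * T i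
  braid : ∀ i, i + 1 < n → T i * T (i + 1) * T i = T (i + 1) * T i * T (i + 1)

/-- Relations between operators that are given by `localOp` on a spanning set may be checked
letterwise. -/
lemma heckeRel_of_localOp {K Y X M : Type*} [Field K] [AddCommGroup M] [Module K M] {r : ℕ}
    {z : K} {α β : Y → Y → K} (T : ℕ → Module.End K M) (ι : M →ₗ[K] ((Fin r → Y) →₀ K))
    (hι : Function.Injective ι)
    (hT : ∀ (i : ℕ) (h : i + 1 < r) (y : M),
      ι (T i y) = localOp α β ⟨i, Nat.lt_of_succ_lt h⟩ ⟨i + 1, h⟩ (ι y))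
    (e : X → M) (he : Submodule.span K (Set.range e) = ⊤) (v : X → Fin r → Y)
    (hv : ∀ x, ι (e x) = Finsupp.single (v x) 1)
    (hq : ∀ x (i : ℕ) (h : i + 1 < r), QuadAt z α β (v x ⟨i, Nat.lt_of_succ_lt h⟩) (v x ⟨i + 1, h⟩))
    (hb : ∀ x (i : ℕ) (h : i + 2 < r), BraidAt α β (v x ⟨i, by omega⟩) (v x ⟨i + 1, by omega⟩)
      (v x ⟨i + 2, h⟩)) :
    HeckeRel z (r - 1) T where
  quad i hi := by
    refine LinearMap.ext_on_range he fun x => hι ?_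
    have h : i + 1 < r := by omega
    simpa [hT i h, hv] using localOp_quad (hq x i h)
  comm i j hij hj := by
    refine LinearMap.ext_on_range he fun x => hι ?_
    have h : i + 1 < r := by omega
    have h' : j + 1 < r := by omega
    simp only [Module.End.mul_apply, hT i h, hT j h', hv]
    apply localOp_comm <;> simp <;> omega
  braid i hi := by
    refine LinearMap.ext_on_range he fun x => hι ?_
    have h : i + 1 < r := by omega
    have h' : i + 1 + 1 < r := by omega
    simp only [Module.End.mul_apply, hT i h, hT (i + 1) h', hv]
    apply localOp_braid
    · simp
    · simp
    · simp [add_assoc]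
    · exact hb x i h'

section Bound

variable {K E : Type*} [Field K] [Ring E] [Algebra K E] {z : K} {n : ℕ} {T : ℕ → E}

/-- The descending product `T k * T (k - 1) * ⋯` with `j` factors. -/
def descProd (T : ℕ → E) (k : ℕ) : ℕ → E
  | 0 => 1
  | j + 1 => descProd T k j * T (k - j)

lemma HeckeRel.mul_descProd_comm (hT : HeckeRel z n T) {k i : ℕ} (hk : k < n) {j : ℕ}
    (h : i + j < k) : descProd T k j * T i = T i * descProd T k j := by
  induction j with
  | zero => simp [descProd]
  | succ j ih =>
    rw [descProd, mul_assoc, ← hT.comm i (k - j) (by omega) (by omega), ← mul_assoc,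
      ih (by omega), mul_assoc]

lemma HeckeRel.descProd_mul_shift (hT : HeckeRel z n T) {k i : ℕ} (hk : k < n) {j : ℕ}
    (hjk : j ≤ k + 1) (h : k + 1 < i + j) (hi : i ≤ k) :
    descProd T k j * T i = T (i - 1) * descProd T k j := by
  induction j with
  | zero => omega
  | succ j ih =>
    by_cases hj : k + 1 < i + j
    · rw [descProd, mul_assoc, hT.comm (k - j) i (by omega) (by omega), ← mul_assoc,
        ih (by omega) hj, mul_assoc]
    · obtain ⟨l, rfl⟩ : ∃ l, j = l + 1 := ⟨j - 1, by omega⟩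
      obtain ⟨d, rfl⟩ : ∃ d, i = d + 1 := ⟨i - 1, by omega⟩
      have e1 : k - l = d + 1 := by omega
      have e2 : k - (l + 1) = d := by omega
      have hb := hT.braid d (by omega)
      have hc := hT.mul_descProd_comm (k := k) (i := d) hk (j := l) (by omega)
      simp only [descProd, e1, e2, Nat.add_sub_cancel]
      calc descProd T k l * T (d + 1) * T d * T (d + 1)
          = descProd T k l * (T (d + 1) * T d * T (d + 1)) := by simp only [mul_assoc]
        _ = descProd T k l * T d * (T (d + 1) * T d) := by rw [← hb]; simp only [mul_assoc]
        _ = T d * (descProd T k l * T (d + 1) * T d) := by rw [hc]; simp only [mul_assoc]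

lemma finrank_iSup_le {ι V : Type*} [AddCommGroup V] [Module K V] [FiniteDimensional K V]
    [Fintype ι] (p : ι → Submodule K V) :
    Module.finrank K (⨆ i, p i : Submodule K V) ≤ ∑ i, Module.finrank K (p i) := by
  classical
  rw [← Finset.sup_univ_eq_iSup]
  induction (Finset.univ : Finset ι) using Finset.induction_on with
  | empty => simp
  | insert a s ha ih =>
    rw [Finset.sup_insert, Finset.sum_insert ha]
    exact (Submodule.finrank_add_le_finrank_add_finrank _ _).trans (by lia)

/-- A Hecke algebra with `k` generators has dimension at most `(k + 1)!`. -/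
lemma HeckeRel.finrank_adjoin_le [FiniteDimensional K E] (hT : HeckeRel z n T) :
    ∀ k ≤ n, Module.finrank K (Algebra.adjoin K (T '' Set.Iio k)) ≤ (k + 1).factorial := by
  intro k
  induction k with
  | zero =>
    intro _
    have e : Algebra.adjoin K (T '' Set.Iio 0) = ⊥ := by
      rw [show Set.Iio 0 = (∅ : Set ℕ) by ext; simp, Set.image_empty, Algebra.adjoin_empty]
    rw [← Subalgebra.finrank_toSubmodule, e, Algebra.toSubmodule_bot, Submodule.one_eq_span]
    exact (finrank_span_le_card _).trans (by simp)
  | succ k ih =>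
    intro hk
    set A : Subalgebra K E := Algebra.adjoin K (T '' Set.Iio k) with hA
    have hTA : ∀ i < k, T i ∈ A := fun i hi => Algebra.subset_adjoin ⟨i, hi, rfl⟩
    let S : Submodule K E := ⨆ j : Fin (k + 2),
      (Subalgebra.toSubmodule A).map (LinearMap.mulRight K (descProd T k j))
    have hmem : ∀ j < k + 2, ∀ a ∈ A, a * descProd T k j ∈ S := fun j hj a ha =>
      Submodule.mem_iSup_of_mem (⟨j, hj⟩ : Fin (k + 2)) ⟨a, ha, rfl⟩
    have hmulT : ∀ i < k + 1, ∀ s ∈ S, s * T i ∈ S := by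
      intro i hi s hs
      induction hs using Submodule.iSup_induction' with
      | zero => simp
      | add x y _ _ hx hy => rw [add_mul]; exact S.add_mem hx hy
      | mem j x hx =>
        obtain ⟨a, ha, rfl⟩ := hx
        obtain ⟨j, hj⟩ := j
        simp only [LinearMap.mulRight_apply, mul_assoc]
        rcases lt_trichotomy (i + j) k with h | h | h
        · rw [hT.mul_descProd_comm (by omega) h, ← mul_assoc]
          exact hmem j hj _ (A.mul_mem ha (hTA i (by omega)))
        · have e : i = k - j := by omega
          subst e
          exact hmem (j + 1) (by omega) a ha
        · by_cases h' : i + j = k + 1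
          · obtain ⟨l, rfl⟩ : ∃ l, j = l + 1 := ⟨j - 1, by omega⟩
            have e : k - l = i := by omega
            have : descProd T k (l + 1) * T i = z • descProd T k (l + 1) + descProd T k l := by
              simp only [descProd, e, mul_assoc, hT.quad i (by omega), mul_add, mul_one,
                mul_smul_comm]
            rw [this, mul_add, mul_smul_comm]
            exact S.add_mem (S.smul_mem _ (hmem _ hj a ha)) (hmem l (by omega) a ha)
          · rw [hT.descProd_mul_shift (by omega) (by omega) (by omega) (by omega), ← mul_assoc]
            exact hmem j hj _ (A.mul_mem ha (hTA _ (by omega)))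
    have hle : Subalgebra.toSubmodule (Algebra.adjoin K (T '' Set.Iio (k + 1))) ≤ S := by
      have key : ∀ x ∈ Algebra.adjoin K (T '' Set.Iio (k + 1)), ∀ s ∈ S, s * x ∈ S := by
        intro x hx
        induction hx using Algebra.adjoin_induction with
        | mem x hx => obtain ⟨i, hi, rfl⟩ := hx; exact hmulT i hi
        | algebraMap c =>
          intro s hs
          rw [← Algebra.commutes, ← Algebra.smul_def]
          exact S.smul_mem _ hs
        | add x y _ _ hx hy =>
          intro s hs
          rw [mul_add]
          exact S.add_mem (hx s hs) (hy s hs)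
        | mul x y _ _ hx hy =>
          intro s hs
          rw [← mul_assoc]
          exact hy _ (hx s hs)
      intro x hx
      have := key x hx 1 (by simpa [descProd] using hmem 0 (by omega) 1 A.one_mem)
      rwa [one_mul] at this
    calc Module.finrank K (Algebra.adjoin K (T '' Set.Iio (k + 1)))
        ≤ Module.finrank K S := by
          rw [← Subalgebra.finrank_toSubmodule]
          exact Submodule.finrank_mono hle
      _ ≤ ∑ _j : Fin (k + 2), (k + 1).factorial := by
          refine (finrank_iSup_le _).trans (Finset.sum_le_sum fun j _ => ?_)
          refine (Submodule.finrank_map_le _ _).trans ?_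
          rw [Subalgebra.finrank_toSubmodule]
          exact ih (by omega)
      _ = (k + 1 + 1).factorial := by
          simp [Nat.factorial_succ (k + 1)]

end Bound

/-- A standard tableau, given as the sequence of its cells in the order of their entries: every
cell weakly north-west of an occurring cell has occurred before. -/
def IsStd {r : ℕ} (t : Fin r → ℕ × ℕ) : Prop :=
  Function.Injective t ∧ ∀ i c, c ≤ t i → ∃ j ≤ i, t j = c

/-- The standard tableaux with `r` cells, of all shapes. -/
def SYT (r : ℕ) : Type := {t : Fin r → ℕ × ℕ // IsStd t}

/-- The content of a cell. -/
def content (c : ℕ × ℕ) : ℤ := (c.2 : ℤ) - c.1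

lemma IsStd.lt_of_lt {r : ℕ} {t : Fin r → ℕ × ℕ} (ht : IsStd t) {i j : Fin r} (h : t i < t j) :
    i < j := by
  obtain ⟨k, hk, e⟩ := ht.2 j (t i) h.le
  rw [← ht.1 e]
  exact lt_of_le_of_ne hk fun h' => by rw [h'] at e; exact h.ne e.symm

lemma IsStd.coord_lt {r : ℕ} {t : Fin r → ℕ × ℕ} (ht : IsStd t) (i : Fin r) :
    (t i).1 < r ∧ (t i).2 < r := by
  constructor
  · have h : ∀ x : Fin ((t i).1 + 1), ∃ j, t j = ((x : ℕ), (t i).2) := fun x =>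
      (ht.2 i _ (by exact ⟨Nat.lt_succ_iff.1 x.2, le_rfl⟩)).imp fun _ h => h.2
    choose f hf using h
    have : Function.Injective f := fun x y hxy => by
      have := hf x; rw [hxy, hf y] at this; exact Fin.ext (Prod.ext_iff.1 this).1.symm
    simpa using Fintype.card_le_of_injective f this
  · have h : ∀ x : Fin ((t i).2 + 1), ∃ j, t j = ((t i).1, (x : ℕ)) := fun x =>
      (ht.2 i _ (by exact ⟨le_rfl, Nat.lt_succ_iff.1 x.2⟩)).imp fun _ h => h.2
    choose f hf using h
    have : Function.Injective f := fun x y hxy => by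
      have := hf x; rw [hxy, hf y] at this; exact Fin.ext (Prod.ext_iff.1 this).2.symm
    simpa using Fintype.card_le_of_injective f this

instance (r : ℕ) : Finite (SYT r) := by
  let f : SYT r → (Fin r → Fin r × Fin r) := fun t i =>
    (⟨(t.1 i).1, (t.2.coord_lt i).1⟩, ⟨(t.1 i).2, (t.2.coord_lt i).2⟩)
  refine Finite.of_injective f fun s t h => Subtype.ext (funext fun i => ?_)
  have := congrFun h i
  simp only [f, Prod.mk.injEq, Fin.mk.injEq] at this
  exact Prod.ext this.1 this.2

noncomputable instance (r : ℕ) : Fintype (SYT r) := Fintype.ofFinite _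

noncomputable instance (r : ℕ) : DecidableEq (SYT r) := Classical.decEq _

/-- The shape of a standard tableau. -/
def SYT.shape {r : ℕ} (t : SYT r) : Finset (ℕ × ℕ) := Finset.univ.image t.1

lemma SYT.mem_shape {r : ℕ} {t : SYT r} {c : ℕ × ℕ} : c ∈ t.shape ↔ ∃ i, t.1 i = c := by
  simp [shape]

lemma SYT.isLowerSet_shape {r : ℕ} (t : SYT r) : IsLowerSet (t.shape : Set (ℕ × ℕ)) := by
  intro c d hdc hc
  obtain ⟨i, rfl⟩ := mem_shape.1 hc
  obtain ⟨j, -, h⟩ := t.2.2 i d hdc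
  exact mem_shape.2 ⟨j, h⟩

lemma SYT.card_shape {r : ℕ} (t : SYT r) : t.shape.card = r := by
  simp [shape, Finset.card_image_of_injective _ t.2.1]

section Corners

/-- The cells which may be added to a diagram. -/
noncomputable def addCells (D : Finset (ℕ × ℕ)) : Finset (ℕ × ℕ) := by
  classical
  exact (Finset.range (D.card + 1) ×ˢ Finset.range (D.card + 1)).filter fun c =>
    c ∉ D ∧ IsLowerSet ((insert c D : Finset (ℕ × ℕ)) : Set (ℕ × ℕ))

/-- The cells which may be removed from a diagram. -/
noncomputable def remCells (D : Finset (ℕ × ℕ)) : Finset (ℕ × ℕ) := by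
  classical
  exact D.filter fun c => IsLowerSet ((D.erase c : Finset (ℕ × ℕ)) : Set (ℕ × ℕ))

lemma lt_card_of_mem {D : Finset (ℕ × ℕ)} (hD : IsLowerSet (D : Set (ℕ × ℕ))) {c : ℕ × ℕ}
    (hc : c ∈ D) : c.1 < D.card ∧ c.2 < D.card := by
  constructor
  · have : (Finset.range (c.1 + 1)).image (fun x => (x, c.2)) ⊆ D := by
      intro d hd
      obtain ⟨x, hx, rfl⟩ := Finset.mem_image.1 hd
      exact hD (show ((x, c.2) : ℕ × ℕ) ≤ c from ⟨by simpa [Nat.lt_succ_iff] using hx, le_rfl⟩) hc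
    have h := Finset.card_le_card this
    rw [Finset.card_image_of_injective _ fun x y h => (Prod.ext_iff.1 h).1] at h
    simpa using h
  · have : (Finset.range (c.2 + 1)).image (fun x => (c.1, x)) ⊆ D := by
      intro d hd
      obtain ⟨x, hx, rfl⟩ := Finset.mem_image.1 hd
      exact hD (show ((c.1, x) : ℕ × ℕ) ≤ c from ⟨le_rfl, by simpa [Nat.lt_succ_iff] using hx⟩) hc
    have h := Finset.card_le_card this
    rw [Finset.card_image_of_injective _ fun x y h => (Prod.ext_iff.1 h).2] at h
    simpa using h

lemma mem_addCells {D : Finset (ℕ × ℕ)} {c : ℕ × ℕ} :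
    c ∈ addCells D ↔ c ∉ D ∧ IsLowerSet ((insert c D : Finset (ℕ × ℕ)) : Set (ℕ × ℕ)) := by
  simp only [addCells, Finset.mem_filter, Finset.mem_product, Finset.mem_range,
    and_iff_right_iff_imp]
  rintro ⟨h1, h2⟩
  simpa [Finset.card_insert_of_notMem h1] using lt_card_of_mem h2 (Finset.mem_insert_self c D)

lemma mem_remCells {D : Finset (ℕ × ℕ)} {c : ℕ × ℕ} :
    c ∈ remCells D ↔ c ∈ D ∧ IsLowerSet ((D.erase c : Finset (ℕ × ℕ)) : Set (ℕ × ℕ)) := by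
  simp [remCells]

lemma mem_remCells_insert_iff {D : Finset (ℕ × ℕ)} (hD : IsLowerSet (D : Set (ℕ × ℕ)))
    {c d : ℕ × ℕ} :
    c ∈ addCells D ∧ d ∈ (remCells (insert c D)).erase c ↔
      d ∈ remCells D ∧ c ∈ (addCells (D.erase d)).erase d := by
  simp only [mem_addCells, mem_remCells, Finset.mem_erase]
  constructor
  · rintro ⟨⟨h1, h2⟩, h3, h4, h5⟩
    have hd : d ∈ D := (Finset.mem_insert.1 h4).resolve_left h3
    refine ⟨⟨hd, ?_⟩, Ne.symm h3, fun h => h1 h.2, ?_⟩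
    · convert hD.inter h5 using 1
      ext x; simp; grind
    · convert h5 using 1
      ext x; simp; grind
  · rintro ⟨⟨h1, h2⟩, h3, h4, h5⟩
    have hc : c ∉ D := fun h => h4 ⟨h3, h⟩
    refine ⟨⟨hc, ?_⟩, Ne.symm h3, Finset.mem_insert_of_mem h1, ?_⟩
    · convert hD.union h5 using 1
      ext x; simp; grind
    · convert h5 using 1
      ext x; simp; grind

lemma card_addCells {D : Finset (ℕ × ℕ)} (hD : IsLowerSet (D : Set (ℕ × ℕ))) :
    (addCells D).card = (remCells D).card + 1 := by
  let μ : YoungDiagram := ⟨D, hD⟩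
  have hmem : ∀ x y, (x, y) ∈ D ↔ y < μ.rowLen x := fun x y => by
    rw [← YoungDiagram.mem_iff_lt_rowLen]; rfl
  have hanti : ∀ x y, x ≤ y → μ.rowLen y ≤ μ.rowLen x := fun x y h => μ.rowLen_anti x y h
  have hadd : ∀ x y, (x, y) ∈ addCells D ↔
      y = μ.rowLen x ∧ (x = 0 ∨ μ.rowLen x < μ.rowLen (x - 1)) := by
    intro x y
    rw [mem_addCells, hmem]
    constructor
    · rintro ⟨h1, h2⟩
      constructor
      · by_contra hne
        have : (x, y - 1) ∈ insert (x, y) D :=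
          h2 (show ((x, y - 1) : ℕ × ℕ) ≤ (x, y) from ⟨le_rfl, Nat.sub_le _ _⟩)
            (Finset.mem_insert_self _ _)
        rw [Finset.mem_insert, hmem, Prod.mk.injEq] at this
        lia
      · by_contra! hne
        have : (x - 1, y) ∈ insert (x, y) D :=
          h2 (show ((x - 1, y) : ℕ × ℕ) ≤ (x, y) from ⟨Nat.sub_le _ _, le_rfl⟩)
            (Finset.mem_insert_self _ _)
        rw [Finset.mem_insert, hmem, Prod.mk.injEq] at this
        lia
    · rintro ⟨rfl, h⟩
      refine ⟨lt_irrefl _, ?_⟩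
      rintro ⟨a1, a2⟩ ⟨b1, b2⟩ ⟨hb1, hb2⟩ ha
      simp only [Finset.coe_insert, Set.mem_insert_iff, Prod.mk.injEq, Finset.mem_coe, hmem] at ha ⊢
      dsimp only at hb1 hb2
      rcases ha with ⟨rfl, rfl⟩ | ha
      · rcases eq_or_lt_of_le hb1 with rfl | hb1
        · lia
        · have := hanti b1 (a1 - 1) (by lia)
          lia
      · have := hanti b1 a1 hb1
        lia
  have hrem : ∀ x y, (x, y) ∈ remCells D ↔ y + 1 = μ.rowLen x ∧ μ.rowLen (x + 1) < μ.rowLen x := by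
    intro x y
    rw [mem_remCells, hmem]
    constructor
    · rintro ⟨h1, h2⟩
      have key : ∀ c : ℕ × ℕ, (x, y) < c → c ∉ D := fun c hc hcD => by
        have := h2 hc.le (Finset.mem_erase.2 ⟨hc.ne', hcD⟩)
        simp at this
      have k1 := key (x, y + 1) (by simp)
      have k2 := key (x + 1, y) (by simp)
      rw [hmem] at k1 k2
      lia
    · rintro ⟨h1, h2⟩
      refine ⟨by lia, ?_⟩
      rintro ⟨a1, a2⟩ ⟨b1, b2⟩ ⟨hb1, hb2⟩ ha
      simp only [Finset.coe_erase, Set.mem_sdiff, Set.mem_singleton_iff, Prod.mk.injEq,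
        Finset.mem_coe, hmem] at ha ⊢
      dsimp only at hb1 hb2
      have := hanti b1 a1 hb1
      refine ⟨by lia, ?_⟩
      rintro ⟨rfl, rfl⟩
      rcases eq_or_lt_of_le hb1 with rfl | hb1
      · lia
      · have := hanti (b1 + 1) a1 hb1
        lia
  have : addCells D = insert (0, μ.rowLen 0)
      ((remCells D).image fun c => (c.1 + 1, μ.rowLen (c.1 + 1))) := by
    ext ⟨x, y⟩
    simp only [hadd, Finset.mem_insert, Prod.mk.injEq, Finset.mem_image, Prod.exists, hrem]
    constructor
    · rintro ⟨rfl, h⟩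
      rcases Nat.eq_zero_or_pos x with rfl | hx
      · simp
      · right
        obtain ⟨w, rfl⟩ : ∃ w, x = w + 1 := ⟨x - 1, by lia⟩
        simp only [Nat.add_sub_cancel] at h
        exact ⟨w, μ.rowLen w - 1, by lia, rfl, rfl⟩
    · rintro (⟨rfl, rfl⟩ | ⟨a, b, ⟨h1, h2⟩, rfl, rfl⟩)
      · simp
      · simp [h2]
  rw [this, Finset.card_insert_of_notMem (by simp), Finset.card_image_of_injOn]
  rintro ⟨a, b⟩ hab ⟨c, d⟩ hcd h
  simp only [Finset.mem_coe, hrem] at hab hcd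
  simp only [Prod.mk.injEq] at h ⊢
  have : a = c := by lia
  subst this
  lia

end Corners

/-- The tableau with its largest entry removed. -/
def SYT.dropLast {r : ℕ} (t : SYT (r + 1)) : SYT r :=
  ⟨Fin.init t.1, fun i j h => Fin.castSucc_injective _ (t.2.1 h), fun i c hc => by
    obtain ⟨j, hj, rfl⟩ := t.2.2 i.castSucc c hc
    refine ⟨⟨j, lt_of_le_of_lt hj i.2⟩, hj, rfl⟩⟩

/-- The tableau with a cell added, which is filled with the new largest entry. -/
def SYT.snoc {r : ℕ} (t : SYT r) (c : ℕ × ℕ) (hc : c ∈ addCells t.shape) : SYT (r + 1) :=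
  ⟨Fin.snoc t.1 c, by
    obtain ⟨h1, h2⟩ := mem_addCells.1 hc
    constructor
    · exact Fin.snoc_injective_iff.2 ⟨t.2.1, fun ⟨i, hi⟩ => h1 (mem_shape.2 ⟨i, hi⟩)⟩
    · intro i d
      refine Fin.lastCases (fun hd => ?_) (fun i hd => ?_) i
      · rw [Fin.snoc_last] at hd
        have := h2 hd (Finset.mem_insert_self _ _)
        rcases Finset.mem_insert.1 this with rfl | h
        · exact ⟨Fin.last r, le_rfl, by simp⟩
        · obtain ⟨j, rfl⟩ := mem_shape.1 h
          exact ⟨j.castSucc, Fin.le_last _, by simp⟩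
      · rw [Fin.snoc_castSucc] at hd
        obtain ⟨j, hj, rfl⟩ := t.2.2 i d hd
        exact ⟨j.castSucc, by simpa using hj, by simp⟩⟩

lemma SYT.shape_snoc {r : ℕ} (t : SYT r) (c : ℕ × ℕ) (hc : c ∈ addCells t.shape) :
    (t.snoc c hc).shape = insert c t.shape := by
  ext d
  rw [mem_shape, Finset.mem_insert, mem_shape, Fin.exists_fin_succ']
  simp [snoc, or_comm, eq_comm]

lemma SYT.shape_eq_insert {r : ℕ} (t : SYT (r + 1)) :
    t.shape = insert (t.1 (Fin.last r)) t.dropLast.shape := by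
  ext d
  rw [mem_shape, Finset.mem_insert, mem_shape, Fin.exists_fin_succ']
  simp [dropLast, Fin.init, or_comm, eq_comm]

lemma SYT.last_mem_addCells {r : ℕ} (t : SYT (r + 1)) :
    t.1 (Fin.last r) ∈ addCells t.dropLast.shape := by
  rw [mem_addCells, ← t.shape_eq_insert]
  refine ⟨fun h => ?_, t.isLowerSet_shape⟩
  obtain ⟨i, hi⟩ := mem_shape.1 h
  exact (Fin.castSucc_lt_last i).ne (t.2.1 hi)

/-- A tableau with `r + 1` cells is a tableau with `r` cells together with an addable cell. -/
def SYT.succEquiv (r : ℕ) : SYT (r + 1) ≃ Σ t : SYT r, {c // c ∈ addCells t.shape} where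
  toFun t := ⟨t.dropLast, t.1 (Fin.last r), t.last_mem_addCells⟩
  invFun p := p.1.snoc p.2.1 p.2.2
  left_inv t := Subtype.ext (by simp [snoc, dropLast])
  right_inv p := by
    obtain ⟨t, c, hc⟩ := p
    have h : (t.snoc c hc).dropLast = t := Subtype.ext (by simp [snoc, dropLast])
    refine Sigma.ext h ?_
    refine (Subtype.heq_iff_coe_eq fun x => ?_).2 (by simp [snoc])
    dsimp only
    rw [h]

lemma SYT.sum_succ {r : ℕ} {A : Type*} [AddCommMonoid A] (F : Finset (ℕ × ℕ) → A) :
    ∑ t : SYT (r + 1), F t.shape = ∑ t : SYT r, ∑ c ∈ addCells t.shape, F (insert c t.shape) := by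
  rw [← (succEquiv r).symm.sum_comp, Fintype.sum_sigma]
  refine Finset.sum_congr rfl fun t _ => ?_
  rw [← Finset.sum_coe_sort (addCells t.shape) fun c => F (insert c t.shape)]
  exact Finset.sum_congr rfl fun c _ => by rw [← t.shape_snoc c.1 c.2]; rfl

/-- The number of standard tableaux with `r` cells and shape `D`. -/
noncomputable def numSYT (r : ℕ) (D : Finset (ℕ × ℕ)) : ℕ :=
  ∑ t : SYT r, if t.shape = D then 1 else 0

lemma numSYT_succ {r : ℕ} {D : Finset (ℕ × ℕ)} (hD : IsLowerSet (D : Set (ℕ × ℕ))) :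
    numSYT (r + 1) D = ∑ c ∈ remCells D, numSYT r (D.erase c) := by
  simp only [numSYT]
  rw [SYT.sum_succ fun E => if E = D then 1 else 0, Finset.sum_comm]
  refine Finset.sum_congr rfl fun t _ => ?_
  rw [← Finset.sum_filter, ← Finset.sum_filter]
  congr 1
  ext c
  simp only [Finset.mem_filter, mem_addCells, mem_remCells]
  constructor
  · rintro ⟨⟨h1, h2⟩, rfl⟩
    rw [Finset.erase_insert h1]
    exact ⟨⟨Finset.mem_insert_self _ _, t.isLowerSet_shape⟩, rfl⟩
  · rintro ⟨⟨h1, h2⟩, h3⟩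
    rw [h3, Finset.insert_erase h1]
    exact ⟨⟨Finset.notMem_erase _ _, hD⟩, rfl⟩

lemma sum_numSYT_insert {r : ℕ} {D : Finset (ℕ × ℕ)} (hD : IsLowerSet (D : Set (ℕ × ℕ)))
    (hr : D.card = r) :
    ∑ c ∈ addCells D, numSYT (r + 1) (insert c D) = (r + 1) * numSYT r D := by
  induction r generalizing D with
  | zero =>
    obtain rfl := Finset.card_eq_zero.1 hr
    have h0 : remCells ∅ = ∅ := by ext; simp [mem_remCells]
    have h := card_addCells hD
    rw [h0, Finset.card_empty] at h
    obtain ⟨c, hc⟩ := Finset.card_eq_one.1 h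
    have hc' := mem_addCells.1 (hc ▸ Finset.mem_singleton_self c)
    rw [hc, Finset.sum_singleton, numSYT_succ hc'.2]
    have : remCells (insert c ∅) = {c} := by
      ext d
      simp only [mem_remCells, insert_empty_eq, Finset.mem_singleton]
      refine ⟨fun h => h.1, fun h => ⟨h, ?_⟩⟩
      subst h
      simp [isLowerSet_empty]
    rw [this, Finset.sum_singleton, Finset.erase_insert (Finset.notMem_empty c)]
    simp
  | succ r ih =>
    have hstep : ∀ c ∈ addCells D, numSYT (r + 1 + 1) (insert c D) = numSYT (r + 1) D +
        ∑ d ∈ (remCells (insert c D)).erase c, numSYT (r + 1) ((insert c D).erase d) := by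
      intro c hc
      obtain ⟨h1, h2⟩ := mem_addCells.1 hc
      have hmem : c ∈ remCells (insert c D) := by
        rw [mem_remCells, Finset.erase_insert h1]
        exact ⟨Finset.mem_insert_self _ _, hD⟩
      rw [numSYT_succ h2, ← Finset.add_sum_erase _ _ hmem, Finset.erase_insert h1]
    have hswap : ∑ c ∈ addCells D, ∑ d ∈ (remCells (insert c D)).erase c,
        numSYT (r + 1) ((insert c D).erase d) =
        ∑ d ∈ remCells D, ∑ c ∈ (addCells (D.erase d)).erase d,
          numSYT (r + 1) (insert c (D.erase d)) := by
      rw [Finset.sum_comm' fun c d => (mem_remCells_insert_iff hD).trans and_comm]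
      refine Finset.sum_congr rfl fun d _ => Finset.sum_congr rfl fun c hc => ?_
      rw [Finset.erase_insert_of_ne (Finset.ne_of_mem_erase hc)]
    have hrem : ∀ d ∈ remCells D, ∑ c ∈ (addCells (D.erase d)).erase d,
        numSYT (r + 1) (insert c (D.erase d)) + numSYT (r + 1) D =
          (r + 1) * numSYT r (D.erase d) := by
      intro d hd
      obtain ⟨h1, h2⟩ := mem_remCells.1 hd
      rw [← ih h2 (by rw [Finset.card_erase_of_mem h1, hr]; rfl)]
      have hmem : d ∈ addCells (D.erase d) := by
        rw [mem_addCells, Finset.insert_erase h1]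
        exact ⟨Finset.notMem_erase _ _, hD⟩
      rw [← Finset.add_sum_erase _ _ hmem, Finset.insert_erase h1, add_comm]
    have hsum := Finset.sum_congr rfl hrem
    rw [Finset.sum_add_distrib, ← Finset.mul_sum, ← numSYT_succ hD, Finset.sum_const,
      smul_eq_mul] at hsum
    rw [Finset.sum_congr rfl hstep, Finset.sum_add_distrib, hswap, Finset.sum_const,
      card_addCells hD, smul_eq_mul]
    linarith

/-- The pairs of standard tableaux of the same shape. -/
abbrev SYTPair (r : ℕ) : Type := {p : SYT r × SYT r // p.1.shape = p.2.shape}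

lemma sum_numSYT_shape (r : ℕ) : ∑ t : SYT r, numSYT r t.shape = r.factorial := by
  induction r with
  | zero =>
    have : Subsingleton (SYT 0) := ⟨fun s t => Subtype.ext (Subsingleton.elim _ _)⟩
    have t : SYT 0 := ⟨Fin.elim0, fun i => i.elim0, fun i => i.elim0⟩
    let : Unique (SYT 0) := ⟨⟨t⟩, fun _ => Subsingleton.elim _ _⟩
    simp [numSYT, Finset.filter_singleton]
  | succ r ih =>
    rw [SYT.sum_succ, Nat.factorial_succ, ← ih, Finset.mul_sum]
    exact Finset.sum_congr rfl fun t _ => sum_numSYT_insert t.isLowerSet_shape t.card_shape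

/-- The number of pairs of standard tableaux of the same shape with `r` cells is `r!`. -/
lemma card_SYTPair (r : ℕ) : Fintype.card (SYTPair r) = r.factorial := by
  rw [← sum_numSYT_shape, Fintype.card_subtype, Finset.card_filter, Fintype.sum_prod_type]
  exact Finset.sum_congr rfl fun t _ => Finset.sum_congr rfl fun s _ => by simp only [eq_comm]

section Words

variable {K : Type*} [Field K] (q : K) (m : ℕ) {N : ℕ}

/-- The diagonal coefficients of `T` on the letters of a word. -/
def wordDiag (a b : Fin N) : K :=
  if a = b then (if (a : ℕ) < m then q else -q⁻¹) else if a < b then q - q⁻¹ else 0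

variable (K) in
/-- The off-diagonal coefficients of `T` on the letters of a word. -/
def wordOff (a b : Fin N) : K := if a = b then 0 else sgn K m a b

lemma sgn_mul_self (a b : Fin N) : sgn K m a b * sgn K m a b = 1 := by
  rw [sgn, ← pow_add, ← two_mul, pow_mul]; simp

lemma sgn_comm (a b : Fin N) : sgn K m a b = sgn K m b a := by
  rw [sgn, sgn, mul_comm]

lemma wordQuadAt {q : K} (hq : q ≠ 0) (a b : Fin N) :
    QuadAt (q - q⁻¹) (wordDiag q m) (wordOff K m) a b := by
  rcases lt_trichotomy a b with h | rfl | h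
  · have := sgn_mul_self (K := K) m a b
    simp [QuadAt, wordDiag, wordOff, h.ne, h.ne', h, h.not_gt, sgn_comm m b a, this]
    ring
  · have : q * q⁻¹ = 1 := mul_inv_cancel₀ hq
    simp only [QuadAt, wordDiag, wordOff]
    simp
    split_ifs <;> linear_combination this
  · have := sgn_mul_self (K := K) m a b
    simp [QuadAt, wordDiag, wordOff, h.ne, h.ne', h, h.not_gt, sgn_comm m b a, this]

lemma wordBraidAt {q : K} (hq : q ≠ 0) (a b c : Fin N) :
    BraidAt (wordDiag q m) (wordOff K m) a b c := by
  have hqq : q * q⁻¹ = 1 := mul_inv_cancel₀ hq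
  have h1 := sgn_mul_self (K := K) m a b
  have h2 := sgn_mul_self (K := K) m b c
  have h3 := sgn_mul_self (K := K) m a c
  have e1 := sgn_comm (K := K) m b a
  have e2 := sgn_comm (K := K) m c b
  have e3 := sgn_comm (K := K) m c a
  have t (x y : Fin N) (h : x < y) : wordDiag q m x y = q - q⁻¹ ∧ wordDiag q m y x = 0 ∧
      wordOff K m x y = sgn K m x y ∧ wordOff K m y x = sgn K m x y := by
    simp [wordDiag, wordOff, h.ne, h.ne', h, h.not_gt, sgn_comm m y x]
  have t' (x : Fin N) : wordOff K m x x = 0 := by simp [wordOff]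
  have t'' (x : Fin N) : (wordDiag q m x x - q) * (wordDiag q m x x + q⁻¹) = 0 := by
    simp only [wordDiag]; simp; split_ifs <;> simp
  have ta := t'' a
  have tb := t'' b
  simp only [BraidAt]
  rcases lt_trichotomy a b with h | h | h
  · obtain ⟨a1, a2, a3, a4⟩ := t _ _ h
    rcases lt_trichotomy b c with h' | h' | h'
    · obtain ⟨b1, b2, b3, b4⟩ := t _ _ h'
      obtain ⟨c1, c2, c3, c4⟩ := t _ _ (h.trans h')
      simp only [*]
      grind
    · subst h'
      simp only [*]
      grind
    · obtain ⟨b1, b2, b3, b4⟩ := t _ _ h'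
      rcases lt_trichotomy a c with h'' | h'' | h''
      · obtain ⟨c1, c2, c3, c4⟩ := t _ _ h''
        simp only [*]
        grind
      · subst h''
        clear e2 e3
        simp only [*]
        grind
      · obtain ⟨c1, c2, c3, c4⟩ := t _ _ h''
        simp only [*]
        grind
  · subst h
    rcases lt_trichotomy a c with h' | h' | h'
    · obtain ⟨b1, b2, b3, b4⟩ := t _ _ h'
      simp only [*]
      grind
    · subst h'
      simp only [*]
      grind
    · obtain ⟨b1, b2, b3, b4⟩ := t _ _ h'
      simp only [*]
      grind
  · obtain ⟨a1, a2, a3, a4⟩ := t _ _ h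
    rcases lt_trichotomy b c with h' | h' | h'
    · obtain ⟨b1, b2, b3, b4⟩ := t _ _ h'
      rcases lt_trichotomy a c with h'' | h'' | h''
      · obtain ⟨c1, c2, c3, c4⟩ := t _ _ h''
        simp only [*]
        grind
      · subst h''
        clear e2 e3
        simp only [*]
        grind
      · obtain ⟨c1, c2, c3, c4⟩ := t _ _ h''
        simp only [*]
        grind
    · subst h'
      simp only [*]
      grind
    · obtain ⟨b1, b2, b3, b4⟩ := t _ _ h'
      obtain ⟨c1, c2, c3, c4⟩ := t _ _ (h'.trans h)
      simp only [*]
      grind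

variable {r : ℕ}

/-- The operators `T_i` on the tensor space, extended by zero. -/
noncomputable def opW (N r : ℕ) (i : ℕ) : Module.End K ((Fin r → Fin N) → K) :=
  if h : i + 1 < r then Matrix.vecMulLinear (heckeOp q q⁻¹ m r i h) else 0

lemma opW_single (i : ℕ) (h : i + 1 < r) (a : Fin r → Fin N) :
    opW q m N r i (Pi.single a 1) =
      wordDiag q m (a ⟨i, Nat.lt_of_succ_lt h⟩) (a ⟨i + 1, h⟩) • Pi.single a 1 +
      wordOff K m (a ⟨i, Nat.lt_of_succ_lt h⟩) (a ⟨i + 1, h⟩) •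
        Pi.single (a ∘ Equiv.swap ⟨i, Nat.lt_of_succ_lt h⟩ ⟨i + 1, h⟩) 1 := by
  have hne : (⟨i, Nat.lt_of_succ_lt h⟩ : Fin r) ≠ ⟨i + 1, h⟩ := by simp
  simp only [opW, h, dif_pos, Matrix.coe_vecMulLinear, Matrix.single_one_vecMul]
  funext b
  simp only [heckeOp, twoSiteOp, Matrix.row, Pi.add_apply, Pi.smul_apply, smul_eq_mul]
  generalize (⟨i, Nat.lt_of_succ_lt h⟩ : Fin r) = s at *
  generalize (⟨i + 1, h⟩ : Fin r) = s' at *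
  rw [Finset.prod_ite_zero]
  have h1 : (Pi.single a 1 : (Fin r → Fin N) → K) b =
      if (b s, b s') = (a s, a s') ∧ ∀ j ∈ Finset.univ \ {s, s'}, a j = b j then 1 else 0 := by
    rw [Pi.single_apply]
    refine if_congr ⟨?_, fun ⟨h1, h2⟩ => funext fun j => ?_⟩ rfl rfl
    · rintro rfl; simp
    · by_cases hj : j ∈ Finset.univ \ {s, s'}
      · exact (h2 j hj).symm
      · simp at h1 hj
        by_cases hs : j = s
        · rw [hs, h1.1]
        · rw [hj hs, h1.2]
  have h2 : (Pi.single (a ∘ Equiv.swap s s') 1 : (Fin r → Fin N) → K) b =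
      if (b s, b s') = (a s', a s) ∧ ∀ j ∈ Finset.univ \ {s, s'}, a j = b j then 1 else 0 := by
    rw [Pi.single_apply]
    refine if_congr ⟨?_, fun ⟨h1, h2⟩ => funext fun j => ?_⟩ rfl rfl
    · rintro rfl
      simp only [Function.comp_apply, Equiv.swap_apply_left, Equiv.swap_apply_right, true_and]
      intro j hj
      simp at hj
      rw [Equiv.swap_apply_of_ne_of_ne hj.1 hj.2]
    · by_cases hj : j ∈ Finset.univ \ {s, s'}
      · rw [← h2 j hj]
        simp at hj
        rw [Function.comp_apply, Equiv.swap_apply_of_ne_of_ne hj.1 hj.2]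
      · simp at h1 hj
        by_cases hs : j = s
        · rw [hs, h1.1]; simp
        · rw [hj hs, h1.2]; simp
  rw [h1, h2]
  simp only [Tent, wordDiag, wordOff, Finset.prod_const_one, Fin.lt_def]
  by_cases hj : ∀ j ∈ Finset.univ \ {s, s'}, a j = b j
  · rw [if_pos hj]
    simp only [and_iff_left hj]
    split_ifs <;> simp_all
  · simp only [hj, and_false]
    simp

lemma opW_heckeRel {q : K} (hq : q ≠ 0) : HeckeRel (q - q⁻¹) (r - 1) (opW q m N r) := by
  let ι : ((Fin r → Fin N) → K) ≃ₗ[K] ((Fin r → Fin N) →₀ K) :=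
    (Finsupp.linearEquivFunOnFinite K K _).symm
  have hι (a : Fin r → Fin N) : ι (Pi.single a 1) = Finsupp.single a 1 := by
    simp [ι]
  refine heckeRel_of_localOp (α := wordDiag q m) (β := wordOff K m) (opW q m N r) ι.toLinearMap
    ι.injective ?_ (fun a : Fin r → Fin N => Pi.single a 1) ?_ id hι
    (fun _ _ _ => wordQuadAt m hq _ _) (fun _ _ _ => wordBraidAt m hq _ _ _)
  · intro i h y
    suffices ι.toLinearMap ∘ₗ opW q m N r i = localOp (wordDiag q m) (wordOff K m)
        ⟨i, Nat.lt_of_succ_lt h⟩ ⟨i + 1, h⟩ ∘ₗ ι.toLinearMap from LinearMap.congr_fun this y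
    refine LinearMap.pi_ext' fun a => LinearMap.ext_ring ?_
    simp [hι, opW_single q m i h, localOp_single]
  · rw [← (Pi.basisFun K (Fin r → Fin N)).span_eq]
    congr 2
    funext a
    simp

end Words

/-- The first of the two positions on which `T_i` acts. -/
abbrev lo {r i : ℕ} (h : i + 1 < r) : Fin r := ⟨i, Nat.lt_of_succ_lt h⟩

/-- The second of the two positions on which `T_i` acts. -/
abbrev hi {r i : ℕ} (h : i + 1 < r) : Fin r := ⟨i + 1, h⟩

/-- Exchange the entries `i` and `i + 1` of a sequence. -/
abbrev swapAt {r i : ℕ} {Y : Type*} (h : i + 1 < r) (a : Fin r → Y) : Fin r → Y :=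
  a ∘ Equiv.swap (lo h) (hi h)

section Standard

variable {r : ℕ} {t : Fin r → ℕ × ℕ}

lemma IsStd.content_ne (ht : IsStd t) {i j : Fin r} (hij : i < j) (hj : (j : ℕ) < i + 3) :
    content (t i) ≠ content (t j) := by
  intro h
  simp only [content] at h
  rcases lt_trichotomy (t i).1 (t j).1 with h1 | h1 | h1
  · have k1 : ((t i).1 + 1, (t i).2) < t j := Prod.lt_iff.2 (by simp; lia)
    have k2 : ((t i).1, (t i).2 + 1) < t j := Prod.lt_iff.2 (by simp; lia)
    obtain ⟨a, -, ha⟩ := ht.2 j _ k1.le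
    obtain ⟨b, -, hb⟩ := ht.2 j _ k2.le
    have a1 := ht.lt_of_lt (ha ▸ k1)
    have b1 := ht.lt_of_lt (hb ▸ k2)
    have a2 : i < a := ht.lt_of_lt (by rw [ha]; exact Prod.lt_iff.2 (Or.inl (by simp)))
    have b2 : i < b := ht.lt_of_lt (by rw [hb]; exact Prod.lt_iff.2 (Or.inr (by simp)))
    have : a ≠ b := by
      rintro rfl
      rw [ha, Prod.mk.injEq] at hb
      lia
    rw [Fin.lt_def] at a1 a2 b1 b2
    have := Fin.val_ne_of_ne this
    lia
  · exact hij.ne (ht.1 (Prod.ext h1 (by lia)))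
  · exact (ht.lt_of_lt (Prod.lt_iff.2 (Or.inl ⟨h1, by lia⟩))).not_gt hij

variable {i : ℕ} (h : i + 1 < r)

lemma IsStd.eq_hi (ht : IsStd t) {c : ℕ × ℕ} (h1 : t (lo h) < c) (h2 : c ≤ t (hi h)) :
    c = t (hi h) := by
  obtain ⟨j, hj, rfl⟩ := ht.2 _ _ h2
  have := ht.lt_of_lt h1
  congr 1
  rw [Fin.lt_def] at this
  rw [Fin.le_def] at hj
  exact Fin.ext (by simp at *; lia)

lemma IsStd.not_hi_lt_lo (ht : IsStd t) : ¬ t (hi h) < t (lo h) := fun h' => by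
  have := ht.lt_of_lt h'
  simp [Fin.lt_def] at this

/-- The content increases by one exactly for neighbours in a row. -/
lemma IsStd.hi_eq_right (ht : IsStd t) (hc : content (t (hi h)) = content (t (lo h)) + 1) :
    t (hi h) = ((t (lo h)).1, (t (lo h)).2 + 1) := by
  simp only [content] at hc
  by_cases h1 : (t (lo h)).1 ≤ (t (hi h)).1
  · exact (ht.eq_hi h (c := ((t (lo h)).1, (t (lo h)).2 + 1)) (Prod.lt_iff.2 (Or.inr (by simp)))
      (Prod.le_def.2 ⟨h1, by lia⟩)).symm
  · exact (ht.not_hi_lt_lo h (Prod.lt_iff.2 (Or.inl ⟨by lia, by lia⟩))).elim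

/-- The content decreases by one exactly for neighbours in a column. -/
lemma IsStd.hi_eq_below (ht : IsStd t) (hc : content (t (lo h)) = content (t (hi h)) + 1) :
    t (hi h) = ((t (lo h)).1 + 1, (t (lo h)).2) := by
  simp only [content] at hc
  by_cases h1 : (t (lo h)).2 ≤ (t (hi h)).2
  · exact (ht.eq_hi h (c := ((t (lo h)).1 + 1, (t (lo h)).2)) (Prod.lt_iff.2 (Or.inl (by simp)))
      (Prod.le_def.2 ⟨by lia, h1⟩)).symm
  · exact (ht.not_hi_lt_lo h (Prod.lt_iff.2 (Or.inr ⟨by lia, by lia⟩))).elim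

lemma IsStd.lo_ne_hi (ht : IsStd t) : t (lo h) ≠ t (hi h) := fun h' => by
  have := ht.1 h'
  simp at this

lemma IsStd.le_iff (ht : IsStd t) : t (lo h) ≤ t (hi h) ↔
    content (t (hi h)) = content (t (lo h)) + 1 ∨ content (t (lo h)) = content (t (hi h)) + 1 := by
  constructor
  · intro hle
    by_cases h1 : (t (lo h)).1 < (t (hi h)).1
    · right
      rw [← ht.eq_hi h (c := ((t (lo h)).1 + 1, (t (lo h)).2)) (Prod.lt_iff.2 (Or.inl (by simp)))
        ⟨h1, hle.2⟩]
      simp only [content]; push_cast; ring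
    · have h2 : (t (lo h)).2 < (t (hi h)).2 := by
        by_contra h2
        exact ht.lo_ne_hi h (Prod.ext (hle.1.antisymm (not_lt.1 h1)) (hle.2.antisymm (not_lt.1 h2)))
      left
      rw [← ht.eq_hi h (c := ((t (lo h)).1, (t (lo h)).2 + 1)) (Prod.lt_iff.2 (Or.inr (by simp)))
        ⟨hle.1, h2⟩]
      simp only [content]; push_cast; ring
  · rintro (h' | h')
    · rw [ht.hi_eq_right h h']; exact ⟨le_rfl, by simp⟩
    · rw [ht.hi_eq_below h h']; exact ⟨by simp, le_rfl⟩

lemma IsStd.swapAt (ht : IsStd t) (hlo : ¬ t (lo h) ≤ t (hi h)) : IsStd (swapAt h t) := by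
  refine ⟨ht.1.comp (Equiv.injective _), fun k c hc => ?_⟩
  obtain ⟨j, hj, rfl⟩ := ht.2 _ _ hc
  refine ⟨Equiv.swap (lo h) (hi h) j, ?_, by simp⟩
  have hlh : (lo h : Fin r) < hi h := by simp [Fin.lt_def]
  simp only [Fin.le_def, Equiv.swap_apply_def, Function.comp_apply] at *
  by_cases hk : k = lo h
  · have : j ≠ lo h := by
      rintro rfl
      simp [hk] at hc
      exact hlo hc
    grind
  · grind

end Standard

/-- Exchange the entries `i` and `i + 1` of a standard tableau, if this is possible. -/
noncomputable def SYT.swap {r i : ℕ} (h : i + 1 < r) (t : SYT r) : SYT r := by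
  classical
  exact if hlo : t.1 (lo h) ≤ t.1 (hi h) then t else ⟨swapAt h t.1, t.2.swapAt h hlo⟩

lemma SYT.swap_of_le {r i : ℕ} {h : i + 1 < r} {t : SYT r} (hlo : t.1 (lo h) ≤ t.1 (hi h)) :
    t.swap h = t := dif_pos hlo

lemma SYT.swap_val {r i : ℕ} {h : i + 1 < r} {t : SYT r} (hlo : ¬ t.1 (lo h) ≤ t.1 (hi h)) :
    (t.swap h).1 = swapAt h t.1 := by
  have : t.swap h = ⟨swapAt h t.1, t.2.swapAt h hlo⟩ := dif_neg hlo
  rw [this]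

lemma SYT.shape_swap {r i : ℕ} {h : i + 1 < r} (t : SYT r) : (t.swap h).shape = t.shape := by
  by_cases hlo : t.1 (lo h) ≤ t.1 (hi h)
  · rw [swap_of_le hlo]
  · ext c
    rw [mem_shape, mem_shape, swap_val hlo]
    exact (Equiv.swap (lo h) (hi h)).exists_congr_left.trans (by simp)

section Seminormal

variable {K : Type*} [Field K] (q : K)

/-- The diagonal coefficients of `T` in Young's seminormal form. -/
noncomputable def tabDiag (a b : ℕ × ℕ) : K :=
  (q - q⁻¹) * q ^ (2 * content b) / (q ^ (2 * content b) - q ^ (2 * content a))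

/-- The off-diagonal coefficients of `T` in Young's seminormal form. -/
noncomputable def tabOff (a b : ℕ × ℕ) : K :=
  if content b = content a + 1 ∨ content a = content b + 1 then 0 else
    (q⁻¹ * q ^ (2 * content b) - q * q ^ (2 * content a)) /
      (q ^ (2 * content b) - q ^ (2 * content a))

variable {q} (hq : q ≠ 0) (hq1 : ∀ k : ℤ, q ^ k = 1 → k = 0)
include hq hq1

lemma pow_content_inj {a b : ℕ × ℕ} (h : q ^ (2 * content a) = q ^ (2 * content b)) :
    content a = content b := by
  have := hq1 (2 * content a - 2 * content b) (by
    rw [zpow_sub₀ hq, h, div_self (zpow_ne_zero _ hq)])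
  lia

lemma pow_content_sub_ne {a b : ℕ × ℕ} (h : content a ≠ content b) :
    q ^ (2 * content a) - q ^ (2 * content b) ≠ 0 :=
  fun h' => h (pow_content_inj hq hq1 (sub_eq_zero.1 h'))

lemma tabDiag_right {a b : ℕ × ℕ} (h : content b = content a + 1) : tabDiag q a b = q := by
  have h0 := pow_content_sub_ne hq hq1 (a := b) (b := a) (by lia)
  rw [tabDiag, div_eq_iff h0]
  rw [h, mul_add, zpow_add₀ hq, show q ^ (2 * 1 : ℤ) = q ^ 2 from zpow_ofNat q 2]
  field_simp

lemma tabDiag_below {a b : ℕ × ℕ} (h : content a = content b + 1) : tabDiag q a b = -q⁻¹ := by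
  have h0 := pow_content_sub_ne hq hq1 (a := b) (b := a) (by lia)
  rw [tabDiag, div_eq_iff h0]
  rw [h, mul_add, zpow_add₀ hq, show q ^ (2 * 1 : ℤ) = q ^ 2 from zpow_ofNat q 2]
  field_simp
  ring

lemma tabOff_mul {a b : ℕ × ℕ} (h : content a ≠ content b) :
    tabOff q a b * tabOff q b a = 1 + (q - q⁻¹) * tabDiag q a b - tabDiag q a b ^ 2 := by
  have h0 := pow_content_sub_ne hq hq1 (a := b) (b := a) h.symm
  have h0' := pow_content_sub_ne hq hq1 (a := a) (b := b) h
  by_cases hr : content b = content a + 1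
  · rw [tabDiag_right hq hq1 hr, tabOff, if_pos (Or.inl hr)]
    field_simp
    ring
  by_cases hb : content a = content b + 1
  · rw [tabDiag_below hq hq1 hb, tabOff, if_pos (Or.inr hb)]
    field_simp
    ring
  rw [tabOff, tabOff, if_neg (by lia), if_neg (by lia), tabDiag]
  field_simp
  ring

lemma tabOff_ne_zero_iff {a b : ℕ × ℕ} (h : content a ≠ content b) :
    tabOff q a b ≠ 0 ↔ ¬ (content b = content a + 1 ∨ content a = content b + 1) := by
  by_cases hab : content b = content a + 1 ∨ content a = content b + 1
  · simp [tabOff, hab]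
  · refine iff_of_true ?_ hab
    rw [tabOff, if_neg hab]
    refine div_ne_zero (fun h' => hab (Or.inl ?_)) (pow_content_sub_ne hq hq1 h.symm)
    have := hq1 (2 * content b - 2 * content a - 2) (by
      rw [zpow_sub₀ hq, zpow_sub₀ hq]
      have := zpow_ne_zero (2 * content a) hq
      field_simp at h' ⊢
      linear_combination h')
    lia

lemma tabDiag_add {a b : ℕ × ℕ} (h : content a ≠ content b) :
    tabDiag q a b + tabDiag q b a = q - q⁻¹ := by
  have h0 := pow_content_sub_ne hq hq1 (a := b) (b := a) h.symm
  have h0' := pow_content_sub_ne hq hq1 (a := a) (b := b) h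
  rw [tabDiag, tabDiag]
  generalize q ^ (2 * content b) = y at *
  generalize q ^ (2 * content a) = x at *
  field_simp
  ring

lemma tabQuadAt {a b : ℕ × ℕ} (h : content a ≠ content b) :
    QuadAt (q - q⁻¹) (tabDiag q) (tabOff q) a b := by
  refine ⟨?_, ?_⟩
  · rw [tabOff_mul hq hq1 h]; ring
  · rw [tabDiag_add hq hq1 h]; ring

lemma tabBraidAt {a b c : ℕ × ℕ} (h : content a ≠ content b) (h' : content b ≠ content c)
    (h'' : content a ≠ content c) : BraidAt (tabDiag q) (tabOff q) a b c := by
  have a1 := pow_content_sub_ne hq hq1 h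
  have a2 := pow_content_sub_ne hq hq1 h.symm
  have a3 := pow_content_sub_ne hq hq1 h'
  have a4 := pow_content_sub_ne hq hq1 h'.symm
  have a5 := pow_content_sub_ne hq hq1 h''
  have a6 := pow_content_sub_ne hq hq1 h''.symm
  refine ⟨?_, mul_eq_zero_of_right _ ?_, mul_eq_zero_of_right _ ?_⟩
  · rw [tabOff_mul hq hq1 h, tabOff_mul hq hq1 h']
    simp only [tabDiag]
    generalize q ^ (2 * content b) = y at *
    generalize q ^ (2 * content a) = x at *
    generalize q ^ (2 * content c) = w at *
    generalize q - q⁻¹ = z at *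
    field_simp
    ring
  all_goals
    simp only [tabDiag]
    generalize q ^ (2 * content b) = y at *
    generalize q ^ (2 * content a) = x at *
    generalize q ^ (2 * content c) = w at *
    generalize q - q⁻¹ = z at *
    field_simp
    ring

omit hq hq1 in
/-- The operators `T_i` of Young's seminormal representation. -/
noncomputable def opM (q : K) (r : ℕ) (i : ℕ) : Module.End K (SYT r →₀ K) :=
  if h : i + 1 < r then Finsupp.linearCombination K fun t : SYT r =>
    tabDiag q (t.1 (lo h)) (t.1 (hi h)) • Finsupp.single t 1 +
      tabOff q (t.1 (lo h)) (t.1 (hi h)) • Finsupp.single (t.swap h) 1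
  else 0

omit hq hq1 in
lemma opM_single {r i : ℕ} (h : i + 1 < r) (t : SYT r) :
    opM q r i (Finsupp.single t 1) = tabDiag q (t.1 (lo h)) (t.1 (hi h)) • Finsupp.single t 1 +
      tabOff q (t.1 (lo h)) (t.1 (hi h)) • Finsupp.single (t.swap h) 1 := by
  simp [opM, h]

omit hq hq1 in
lemma tabOff_of_le {r i : ℕ} {h : i + 1 < r} {t : SYT r} (hlo : t.1 (lo h) ≤ t.1 (hi h)) :
    tabOff q (t.1 (lo h)) (t.1 (hi h)) = 0 :=
  if_pos ((t.2.le_iff h).1 hlo)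

omit hq hq1 in
lemma SYT.content_lo_ne {r i : ℕ} (h : i + 1 < r) (t : SYT r) :
    content (t.1 (lo h)) ≠ content (t.1 (hi h)) :=
  t.2.content_ne (by simp [Fin.lt_def]) (by simp)

lemma tabOff_ne_zero {r i : ℕ} {h : i + 1 < r} {t : SYT r} (hlo : ¬ t.1 (lo h) ≤ t.1 (hi h)) :
    tabOff q (t.1 (lo h)) (t.1 (hi h)) ≠ 0 :=
  (tabOff_ne_zero_iff hq hq1 (t.content_lo_ne h)).2 (hlo ∘ (t.2.le_iff h).2)

lemma opM_heckeRel (r : ℕ) : HeckeRel (q - q⁻¹) (r - 1) (opM q r) := by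
  refine heckeRel_of_localOp (α := tabDiag q) (β := tabOff q) (opM q r)
    (Finsupp.lmapDomain K K fun t : SYT r => t.1)
    (Finsupp.mapDomain_injective Subtype.val_injective) ?_ (fun t => Finsupp.single t 1) ?_
    (fun t => t.1) (fun t => by simp) (fun t i h => tabQuadAt hq hq1 (t.content_lo_ne h))
    (fun t i h => tabBraidAt hq hq1 ?_ ?_ ?_)
  · intro i h y
    suffices (Finsupp.lmapDomain K K fun t : SYT r => t.1) ∘ₗ opM q r i =
        localOp (tabDiag q) (tabOff q) (lo h) (hi h) ∘ₗ
          Finsupp.lmapDomain K K fun t : SYT r => t.1 from LinearMap.congr_fun this y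
    refine Finsupp.lhom_ext' fun t => LinearMap.ext_ring ?_
    simp only [LinearMap.comp_apply, Finsupp.lsingle_apply, opM_single h, map_add, map_smul,
      Finsupp.lmapDomain_apply, Finsupp.mapDomain_single, localOp_single]
    by_cases hlo : t.1 (lo h) ≤ t.1 (hi h)
    · simp only [tabOff_of_le hlo, zero_smul]
    · rw [SYT.swap_val hlo]
  · simpa using (Finsupp.basisSingleOne (R := K) (ι := SYT r)).span_eq
  all_goals exact t.2.content_ne (by simp [Fin.lt_def]) (by simp)

end Seminormal

section Potential

variable {r : ℕ}

/-- A weighted sum of the entries of a sequence, which grows if the sequence gets sorted. -/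
def potential (g : Fin r → ℤ) : ℤ := ∑ k : Fin r, (k : ℤ) * g k

lemma potential_swapAt {i : ℕ} (h : i + 1 < r) (g : Fin r → ℤ) :
    potential (swapAt h g) = potential g + (g (lo h) - g (hi h)) := by
  have hne : (lo h : Fin r) ≠ hi h := by simp
  have h1 : potential (swapAt h g) = ∑ k, ((Equiv.swap (lo h) (hi h) k : Fin r) : ℤ) * g k := by
    rw [potential, ← Equiv.sum_comp (Equiv.swap (lo h) (hi h))]
    simp
  have h2 : ∑ k, (((Equiv.swap (lo h) (hi h) k : Fin r) : ℤ) * g k - (k : ℤ) * g k) =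
      g (lo h) - g (hi h) := by
    rw [Fintype.sum_eq_add (lo h) (hi h) hne]
    · simp only [Equiv.swap_apply_left, Equiv.swap_apply_right]
      push_cast
      ring
    · intro x hx
      rw [Equiv.swap_apply_of_ne_of_ne hx.1 hx.2, sub_self]
  rw [Finset.sum_sub_distrib, ← h1] at h2
  rw [← h2, potential, potential]
  ring

lemma rel_of_adjacent {Y : Type*} {R : Y → Y → Prop} [IsTrans Y R] {f : Fin r → Y}
    (hf : ∀ (i : ℕ) (h : i + 1 < r), R (f (lo h)) (f (hi h))) {i j : Fin r} (hij : i < j) :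
    R (f i) (f j) := by
  have key : ∀ (d i : ℕ) (h : i + d + 1 < r), R (f ⟨i, by lia⟩) (f ⟨i + d + 1, h⟩) := by
    intro d
    induction d with
    | zero => exact fun i h => hf i h
    | succ d ih => exact fun i h => _root_.trans (ih i (by lia)) (hf (i + d + 1) h)
  rw [Fin.lt_def] at hij
  have := key (j - i - 1) i (by lia)
  convert this
  lia

end Potential

section Connectivity

variable {r : ℕ}

/-- `t` is obtained from `s` by successive exchanges of consecutive entries. -/
def Reach : SYT r → SYT r → Prop :=
  Relation.ReflTransGen fun u v => ∃ (i : ℕ) (h : i + 1 < r),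
    ¬ u.1 (lo h) ≤ u.1 (hi h) ∧ v = u.swap h

lemma reach_of_shape_eq {s t : SYT r} (hst : s.shape = t.shape) : Reach s t := by
  classical
  have hshape : ∀ u, Reach s u → u.shape = t.shape := by
    intro u hu
    induction hu with
    | refl => exact hst
    | tail _ h ih => obtain ⟨i, h, -, rfl⟩ := h; rw [SYT.shape_swap, ih]
  let pos : ℕ × ℕ → ℤ := fun c => if hc : ∃ j, t.1 j = c then (hc.choose : Fin r) else 0
  have hpos : ∀ j, pos (t.1 j) = j := by
    intro j
    have hc : ∃ j', t.1 j' = t.1 j := ⟨j, rfl⟩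
    simp only [pos, dif_pos hc, t.2.1 hc.choose_spec]
  obtain ⟨u, hu, hmax⟩ := Set.exists_max_image {u | Reach s u}
    (fun u => potential fun k => pos (u.1 k)) (Set.toFinite _) ⟨s, Relation.ReflTransGen.refl⟩
  have hut : ∀ k, ∃ j, t.1 j = u.1 k := fun k =>
    SYT.mem_shape.1 (hshape u hu ▸ SYT.mem_shape.2 ⟨k, rfl⟩)
  choose π hπ using hut
  have hadj : ∀ (i : ℕ) (h : i + 1 < r), π (lo h) < π (hi h) := by
    intro i h
    by_contra hlt
    have hne : π (lo h) ≠ π (hi h) := fun h' => u.2.lo_ne_hi h (by rw [← hπ, ← hπ, h'])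
    have hlo : ¬ u.1 (lo h) ≤ u.1 (hi h) := by
      intro hle
      have := lt_of_le_of_ne hle (u.2.lo_ne_hi h)
      rw [← hπ, ← hπ] at this
      exact hlt (t.2.lt_of_lt this)
    have := hmax (u.swap h) (hu.tail ⟨i, h, hlo, rfl⟩)
    have e : (fun k => pos ((u.swap h).1 k)) = swapAt h fun k => pos (u.1 k) := by
      rw [SYT.swap_val hlo]; rfl
    simp only [e, potential_swapAt] at this
    simp only [← hπ, hpos] at this
    rw [not_lt, Fin.le_def] at hlt
    have := Fin.val_ne_of_ne hne
    lia
  have hmono : StrictMono π := fun i j hij => rel_of_adjacent (R := (· < ·)) hadj hij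
  have hid : π = id := (hmono.range_inj strictMono_id).1 (by
    rw [(Finite.surjective_of_injective hmono.injective).range_eq, Set.range_id])
  have : u = t := Subtype.ext (funext fun k => by rw [← hπ, hid]; rfl)
  exact this ▸ hu

lemma SYT.ext_content {s t : SYT r} (h : ∀ k, content (s.1 k) = content (t.1 k)) : s = t := by
  have key : ∀ (n : ℕ) (hn : n < r), s.1 ⟨n, hn⟩ = t.1 ⟨n, hn⟩ := by
    intro n
    induction n using Nat.strong_induction_on with
    | _ n ih =>
      intro hn
      have aux : ∀ u v : SYT r, (∀ k (_ : k < n) (hk : k < r), u.1 ⟨k, hk⟩ = v.1 ⟨k, hk⟩) →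
          ¬ u.1 ⟨n, hn⟩ < v.1 ⟨n, hn⟩ := by
        intro u v huv hlt
        obtain ⟨j, hj, e⟩ := v.2.2 _ _ hlt.le
        have hjn : j < ⟨n, hn⟩ := v.2.lt_of_lt (by rw [e]; exact hlt)
        have := u.2.1 ((huv j hjn j.2).trans e)
        exact hjn.ne this
      have h1 := aux s t fun k hk hk' => ih k hk hk'
      have h2 := aux t s fun k hk hk' => (ih k hk hk').symm
      have h3 := h ⟨n, hn⟩
      simp only [content] at h3
      rw [Prod.lt_iff] at h1 h2
      exact Prod.ext (by lia) (by lia)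
  exact Subtype.ext (funext fun k => key k k.2)

end Connectivity

section Units

variable {K : Type*} [Field K] {r : ℕ}

/-- The matrix units. -/
noncomputable def unitM (K : Type*) [Field K] {r : ℕ} (s t : SYT r) : Module.End K (SYT r →₀ K) :=
  Finsupp.lsingle s ∘ₗ Finsupp.lapply t

lemma unitM_single (s t u : SYT r) :
    unitM K s t (Finsupp.single u 1) = if u = t then Finsupp.single s 1 else 0 := by
  simp only [unitM, LinearMap.comp_apply, Finsupp.lapply_apply, Finsupp.lsingle_apply,
    Finsupp.single_apply]
  split_ifs <;> simp

lemma end_ext {f g : Module.End K (SYT r →₀ K)}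
    (h : ∀ u, f (Finsupp.single u 1) = g (Finsupp.single u 1)) : f = g :=
  Finsupp.lhom_ext' fun u => LinearMap.ext_ring (h u)

lemma unitM_mul (s t u v : SYT r) :
    unitM K s t * unitM K u v = if t = u then unitM K s v else 0 := by
  refine end_ext fun w => ?_
  rw [Module.End.mul_apply, unitM_single]
  by_cases h : w = v <;> by_cases h' : t = u <;> simp [h, h', unitM_single, eq_comm]

/-- The Jucys–Murphy elements. -/
def jucysMurphy {E : Type*} [Ring E] (T : ℕ → E) : ℕ → E
  | 0 => 1
  | k + 1 => T k * jucysMurphy T k * T k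

variable {q : K} (hq : q ≠ 0) (hq1 : ∀ k : ℤ, q ^ k = 1 → k = 0)
include hq hq1

lemma jucysMurphy_single (k : ℕ) (hk : k < r) (t : SYT r) :
    jucysMurphy (opM q r) k (Finsupp.single t 1) =
      q ^ (2 * content (t.1 ⟨k, hk⟩)) • Finsupp.single t 1 := by
  induction k generalizing t with
  | zero =>
    obtain ⟨j, hj, h⟩ := t.2.2 ⟨0, hk⟩ (0, 0) ⟨Nat.zero_le _, Nat.zero_le _⟩
    have : j = ⟨0, hk⟩ := Fin.ext (Nat.le_zero.1 hj)
    rw [← this, h]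
    simp [jucysMurphy, content]
  | succ k ih =>
    have hne := t.content_lo_ne hk
    have h0 := pow_content_sub_ne hq hq1 hne
    have h0' := pow_content_sub_ne hq hq1 hne.symm
    have hmul := tabOff_mul hq hq1 hne
    have e1 : tabDiag q (t.1 (lo hk)) (t.1 (hi hk)) *
        (q ^ (2 * content (t.1 (hi hk))) - q ^ (2 * content (t.1 (lo hk)))) =
          (q - q⁻¹) * q ^ (2 * content (t.1 (hi hk))) := by
      rw [tabDiag]; field_simp
    have e2 : tabDiag q (t.1 (hi hk)) (t.1 (lo hk)) *
        (q ^ (2 * content (t.1 (lo hk))) - q ^ (2 * content (t.1 (hi hk)))) =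
          (q - q⁻¹) * q ^ (2 * content (t.1 (lo hk))) := by
      rw [tabDiag]; field_simp
    have hadd := tabDiag_add hq hq1 hne
    simp only [jucysMurphy, Module.End.mul_apply, opM_single hk, map_add, map_smul,
      ih (Nat.lt_of_succ_lt hk)]
    by_cases hlo : t.1 (lo hk) ≤ t.1 (hi hk)
    · have hz := tabOff_of_le (q := q) hlo
      simp only [hz, zero_smul, add_zero, zero_mul] at hmul ⊢
      simp only [smul_smul]
      congr 1
      linear_combination (- tabDiag q (t.1 (lo hk)) (t.1 (hi hk))) * e1 +
        q ^ (2 * content (t.1 (hi hk))) * hmul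
    · have hs : (t.swap hk).swap hk = t := by
        refine Subtype.ext ?_
        have hlo' : ¬ (t.swap hk).1 (lo hk) ≤ (t.swap hk).1 (hi hk) := by
          simp only [SYT.swap_val hlo, Function.comp_apply, Equiv.swap_apply_left,
            Equiv.swap_apply_right]
          exact fun h => t.2.not_hi_lt_lo hk (lt_of_le_of_ne h (t.2.lo_ne_hi hk).symm)
        rw [SYT.swap_val hlo', SYT.swap_val hlo]
        funext x
        simp
      simp only [hs, SYT.swap_val hlo, Function.comp_apply, Equiv.swap_apply_left,
        Equiv.swap_apply_right]
      generalize (Finsupp.single t 1 : SYT r →₀ K) = v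
      generalize (Finsupp.single (t.swap hk) 1 : SYT r →₀ K) = w
      generalize tabDiag q (t.1 (lo hk)) (t.1 (hi hk)) = α at *
      generalize tabDiag q (t.1 (hi hk)) (t.1 (lo hk)) = α' at *
      generalize tabOff q (t.1 (lo hk)) (t.1 (hi hk)) = β at *
      generalize tabOff q (t.1 (hi hk)) (t.1 (lo hk)) = β' at *
      generalize q ^ (2 * content (t.1 (lo hk))) = x at *
      generalize q ^ (2 * content (t.1 (hi hk))) = y at *
      have c1 : α ^ 2 * x + β * β' * y = y := by
        rw [hmul]; linear_combination (-α) * e1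
      have c2 : α * x + α' * y = 0 := by
        linear_combination y * hadd - e1
      linear_combination (norm := module) c1 • v + (β * c2) • w

/-- The algebra generated by the operators of Young's seminormal form. -/
noncomputable def tabAlg (q : K) (r : ℕ) : Subalgebra K (Module.End K (SYT r →₀ K)) :=
  Algebra.adjoin K (opM q r '' Set.Iio (r - 1))

omit hq hq1 in
lemma opM_mem {i : ℕ} (h : i + 1 < r) : opM q r i ∈ tabAlg q r :=
  Algebra.subset_adjoin ⟨i, by simp; lia, rfl⟩

omit hq hq1 in
lemma jucysMurphy_mem (k : ℕ) (hk : k < r) : jucysMurphy (opM q r) k ∈ tabAlg q r := by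
  induction k with
  | zero => exact one_mem _
  | succ k ih => exact mul_mem (mul_mem (opM_mem hk) (ih (by lia))) (opM_mem hk)

lemma unitM_self_mem (t : SYT r) : unitM K t t ∈ tabAlg q r := by
  have key : ∀ S : Finset (SYT r), t ∉ S → ∃ a ∈ tabAlg q r, ∃ f : SYT r → K,
      (∀ u, a (Finsupp.single u 1) = f u • Finsupp.single u 1) ∧ f t = 1 ∧ ∀ s ∈ S, f s = 0 := by
    intro S
    induction S using Finset.induction_on with
    | empty => exact fun _ => ⟨1, one_mem _, fun _ => 1, by simp, rfl, by simp⟩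
    | insert s S hs ih =>
      intro ht
      simp only [Finset.mem_insert, not_or] at ht
      obtain ⟨a, ha, f, hf, hft, hfS⟩ := ih ht.2
      obtain ⟨k, hk⟩ : ∃ k, content (t.1 k) ≠ content (s.1 k) := by
        by_contra! h
        exact ht.1 (SYT.ext_content h)
      have h0 := pow_content_sub_ne hq hq1 hk
      set x := q ^ (2 * content (t.1 k))
      set y := q ^ (2 * content (s.1 k)) with hy
      have hJ : jucysMurphy (opM q r) k ∈ tabAlg q r := jucysMurphy_mem k k.2
      have hb : (x - y)⁻¹ • (jucysMurphy (opM q r) k + (-y) • (1 : Module.End K (SYT r →₀ K))) ∈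
          tabAlg q r :=
        (tabAlg q r).smul_mem (add_mem hJ ((tabAlg q r).smul_mem (tabAlg q r).one_mem (-y))) _
      refine ⟨_, mul_mem hb ha,
        fun u => (x - y)⁻¹ * (q ^ (2 * content (u.1 k)) - y) * f u, fun u => ?_, ?_, ?_⟩
      · simp only [Module.End.mul_apply, hf, map_smul, LinearMap.smul_apply, LinearMap.add_apply,
          jucysMurphy_single hq hq1 _ k.2, Module.End.one_apply]
        module
      · simp only [hft, mul_one]
        exact inv_mul_cancel₀ h0
      · intro u hu
        rcases Finset.mem_insert.1 hu with rfl | hu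
        · simp [hy]
        · simp [hfS u hu]
  obtain ⟨a, ha, f, hf, hft, hfS⟩ := key (Finset.univ.erase t) (by simp)
  convert ha
  refine end_ext fun u => ?_
  rw [hf, unitM_single]
  split_ifs with h
  · rw [h, hft, one_smul]
  · rw [hfS u (by simp [h]), zero_smul]

lemma unitM_mem {s t : SYT r} (hst : s.shape = t.shape) : unitM K s t ∈ tabAlg q r := by
  have := reach_of_shape_eq hst.symm
  induction this with
  | refl => exact unitM_self_mem hq hq1 t
  | @tail u v hu huv ih =>
    obtain ⟨i, h, hlo, rfl⟩ := huv
    have hmem := ih ((SYT.shape_swap u).symm.trans hst)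
    have hoff := tabOff_ne_zero hq hq1 hlo
    have hne : u ≠ u.swap h := fun h' => by
      have := congrFun (congrArg Subtype.val h') (lo h)
      rw [SYT.swap_val hlo] at this
      simp at this
      exact u.2.lo_ne_hi h this
    have : unitM K (u.swap h) u = (tabOff q (u.1 (lo h)) (u.1 (hi h)))⁻¹ •
        (unitM K (u.swap h) (u.swap h) * opM q r i * unitM K u u) := by
      refine end_ext fun w => ?_
      simp only [LinearMap.smul_apply, Module.End.mul_apply, unitM_single]
      split_ifs with hw
      · simp only [opM_single h, map_add, map_smul, unitM_single, if_neg hne, if_true, smul_zero,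
          zero_add]
        rw [smul_smul, inv_mul_cancel₀ hoff, one_smul]
      · simp
    have h2 : unitM K (u.swap h) u ∈ tabAlg q r := by
      rw [this]
      exact Subalgebra.smul_mem _ (mul_mem (mul_mem (unitM_self_mem hq hq1 _) (opM_mem h))
        (unitM_self_mem hq hq1 _)) _
    have h3 : unitM K (u.swap h) t = unitM K (u.swap h) u * unitM K u t := by
      rw [unitM_mul, if_pos rfl]
    rw [h3]
    exact mul_mem h2 hmem

end Units

section Units

variable {K : Type*} [Field K] {r : ℕ}

lemma SYT.swap_swap {i : ℕ} {h : i + 1 < r} (t : SYT r) : (t.swap h).swap h = t := by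
  by_cases hlo : t.1 (lo h) ≤ t.1 (hi h)
  · rw [swap_of_le hlo, swap_of_le hlo]
  · refine Subtype.ext ?_
    have hlo' : ¬ (t.swap h).1 (lo h) ≤ (t.swap h).1 (hi h) := by
      simp only [SYT.swap_val hlo, Function.comp_apply, Equiv.swap_apply_left,
        Equiv.swap_apply_right]
      exact fun h' => t.2.not_hi_lt_lo h (lt_of_le_of_ne h' (t.2.lo_ne_hi h).symm)
    rw [SYT.swap_val hlo', SYT.swap_val hlo]
    funext x
    simp

lemma tabOff_comm_of_le {q : K} {i : ℕ} {h : i + 1 < r} {t : SYT r}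
    (hlo : t.1 (lo h) ≤ t.1 (hi h)) : tabOff q (t.1 (hi h)) (t.1 (lo h)) = 0 :=
  if_pos ((t.2.le_iff h).1 hlo).symm

lemma unitM_mul_opM {q : K} {i : ℕ} (h : i + 1 < r) (s t : SYT r) :
    unitM K s t * opM q r i = tabDiag q (t.1 (lo h)) (t.1 (hi h)) • unitM K s t +
      tabOff q (t.1 (hi h)) (t.1 (lo h)) • unitM K s (t.swap h) := by
  refine end_ext fun u => ?_
  simp only [Module.End.mul_apply, opM_single h, map_add, map_smul, LinearMap.add_apply,
    LinearMap.smul_apply, unitM_single]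
  congr 1
  · split_ifs with hu
    · rw [hu]
    · simp
  · by_cases hu : u = t.swap h
    · subst hu
      rw [SYT.swap_swap, if_pos rfl, if_pos rfl]
      by_cases hlo : t.1 (lo h) ≤ t.1 (hi h)
      · rw [SYT.swap_of_le hlo, tabOff_of_le hlo, tabOff_comm_of_le hlo]
      · rw [SYT.swap_val hlo]; simp
    · rw [if_neg hu, if_neg fun h' => hu (by rw [← h', SYT.swap_swap])]
      simp

lemma linearIndependent_units {E : Type*} [Ring E] [Algebra K E] {e : SYT r → SYT r → E}
    (hmul : ∀ s t u v, s.shape = t.shape → u.shape = v.shape →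
      e s t * e u v = if t = u then e s v else 0)
    (P : SYTPair r → Prop) (hne : ∀ p, P p → e p.1.1 p.1.1 ≠ 0) :
    LinearIndependent K fun p : {p // P p} => e p.1.1.1 p.1.1.2 := by
  classical
  refine Fintype.linearIndependent_iff.2 fun g hg p => ?_
  have h := congrArg (fun x => e p.1.1.1 p.1.1.1 * x * e p.1.1.2 p.1.1.1) hg
  simp only [Finset.mul_sum, Finset.sum_mul, mul_smul_comm, smul_mul_assoc, mul_zero,
    zero_mul] at h
  rw [Fintype.sum_eq_single p] at h
  · rw [hmul _ _ _ _ rfl p.1.2, if_pos rfl, hmul _ _ _ _ p.1.2 p.1.2.symm, if_pos rfl] at h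
    exact (smul_eq_zero.1 h).resolve_right (hne _ p.2)
  · intro x hx
    rw [hmul _ _ _ _ rfl x.1.2]
    split_ifs with h1
    · rw [hmul _ _ _ _ (by rw [h1, x.1.2]) p.1.2.symm, if_neg, smul_zero]
      exact fun h2 => hx (Subtype.ext (Subtype.ext (Prod.ext h1.symm h2)))
    · rw [zero_mul, smul_zero]

/-- If an algebra satisfying the Hecke relations has a full system of matrix units, then these lift
to every other finite-dimensional representation of the Hecke relations. -/
theorem exists_units_aux {q : K} {W M : Type*} [AddCommGroup W] [Module K W] [AddCommGroup M]
    [Module K M] [FiniteDimensional K W] [FiniteDimensional K M]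
    (hr : 1 ≤ r) (T : ℕ → Module.End K W) (hT : HeckeRel (q - q⁻¹) (r - 1) T)
    (TM : ℕ → Module.End K M) (hM : HeckeRel (q - q⁻¹) (r - 1) TM)
    (U : SYT r → SYT r → Module.End K M)
    (hUmem : ∀ s t, s.shape = t.shape → U s t ∈ Algebra.adjoin K (TM '' Set.Iio (r - 1)))
    (hUmul : ∀ s t u v, U s t * U u v = if t = u then U s v else 0)
    (hU0 : ∀ s, U s s ≠ 0)
    (hUT : ∀ (i : ℕ) (h : i + 1 < r) (s t : SYT r),
      U s t * TM i = tabDiag q (t.1 (lo h)) (t.1 (hi h)) • U s t +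
        tabOff q (t.1 (hi h)) (t.1 (lo h)) • U s (t.swap h)) :
    ∃ e : SYT r → SYT r → Module.End K W,
      (∀ s t u v, s.shape = t.shape → u.shape = v.shape →
        e s t * e u v = if t = u then e s v else 0) ∧
      (∀ s t, s.shape = t.shape → ∀ (i : ℕ) (h : i + 1 < r),
        e s t * T i = tabDiag q (t.1 (lo h)) (t.1 (hi h)) • e s t +
          tabOff q (t.1 (hi h)) (t.1 (lo h)) • e s (t.swap h)) ∧
      Subalgebra.toSubmodule (Algebra.adjoin K (T '' Set.Iio (r - 1))) =
        Submodule.span K (Set.range fun p : SYTPair r => e p.1.1 p.1.2) ∧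
      ∀ θ : W →ₗ[K] M, (∀ i < r - 1, θ ∘ₗ T i = TM i ∘ₗ θ) →
        ∀ s t, s.shape = t.shape → θ ∘ₗ e s t = U s t ∘ₗ θ := by
  classical
  let TT : ℕ → Module.End K W × Module.End K M := fun i => (T i, TM i)
  have hTT : HeckeRel (q - q⁻¹) (r - 1) TT :=
    ⟨fun i hi => Prod.ext (hT.quad i hi) (hM.quad i hi),
      fun i j hij hj => Prod.ext (hT.comm i j hij hj) (hM.comm i j hij hj),
      fun i hi => Prod.ext (hT.braid i hi) (hM.braid i hi)⟩
  have hliU : LinearIndependent K fun p : SYTPair r => U p.1.1 p.1.2 :=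
    (linearIndependent_units (fun s t u v _ _ => hUmul s t u v) (fun _ => True)
      fun p _ => hU0 p.1.1).comp (fun p => (⟨p, trivial⟩ : {p : SYTPair r // True}))
      fun _ _ h => congrArg Subtype.val h
  let C := Algebra.adjoin K (TT '' Set.Iio (r - 1))
  have : FiniteDimensional K C :=
    FiniteDimensional.finiteDimensional_submodule (Subalgebra.toSubmodule C)
  have hC : Module.finrank K C ≤ r.factorial := by
    have := hTT.finrank_adjoin_le (r - 1) le_rfl
    rwa [Nat.sub_add_cancel hr] at this
  have hsnd : C.map (AlgHom.snd K _ _) = Algebra.adjoin K (TM '' Set.Iio (r - 1)) := by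
    rw [AlgHom.map_adjoin, ← Set.image_comp]; rfl
  have hfst : C.map (AlgHom.fst K _ _) = Algebra.adjoin K (T '' Set.Iio (r - 1)) := by
    rw [AlgHom.map_adjoin, ← Set.image_comp]; rfl
  have hex : ∀ s t : SYT r, ∃ c : C, s.shape = t.shape → c.1.2 = U s t := by
    intro s t
    by_cases h : s.shape = t.shape
    · have := hUmem s t h
      rw [← hsnd] at this
      obtain ⟨c, hc, hc'⟩ := this
      exact ⟨⟨c, hc⟩, fun _ => hc'⟩
    · exact ⟨0, fun h' => (h h').elim⟩
  choose c hc using hex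
  let f : C →ₗ[K] Module.End K M := LinearMap.snd K _ _ ∘ₗ C.val.toLinearMap
  have hf : ∀ s t : SYT r, s.shape = t.shape → f (c s t) = U s t := hc
  have hli : LinearIndependent K fun p : SYTPair r => c p.1.1 p.1.2 := by
    refine LinearIndependent.of_comp f ?_
    convert hliU using 1
    funext p
    exact hf _ _ p.2
  have hcard : Fintype.card (SYTPair r) = Module.finrank K C :=
    le_antisymm hli.fintype_card_le_finrank (hC.trans (card_SYTPair r).ge)
  have hspan := hli.span_eq_top_of_card_eq_finrank' hcard
  have hinj : Function.Injective f := by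
    rw [← LinearMap.ker_eq_bot, LinearMap.ker_eq_bot']
    intro x hx
    have hmem : x ∈ Submodule.span K (Set.range fun p : SYTPair r => c p.1.1 p.1.2) := by
      rw [hspan]; trivial
    obtain ⟨g, rfl⟩ := (Submodule.mem_span_range_iff_exists_fun K).1 hmem
    have := Fintype.linearIndependent_iff.1 hliU g (by
      rw [← hx, map_sum]
      refine Finset.sum_congr rfl fun p _ => ?_
      rw [map_smul, hf _ _ p.2])
    simp [this]
  refine ⟨fun s t => (c s t).1.1, ?_, ?_, ?_, ?_⟩
  · intro s t u v hst huv
    have : c s t * c u v = if t = u then c s v else 0 := by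
      refine hinj ?_
      have e1 : f (c s t * c u v) = f (c s t) * f (c u v) := rfl
      rw [e1, hf _ _ hst, hf _ _ huv, hUmul]
      split_ifs with h
      · rw [hf]; rw [hst, h, huv]
      · simp
    have := congrArg (fun x : C => x.1.1) this
    rw [apply_ite (fun x : C => x.1.1)] at this
    exact this
  · intro s t hst i h
    let τ : C := ⟨TT i, Algebra.subset_adjoin ⟨i, by simp; lia, rfl⟩⟩
    have : c s t * τ = tabDiag q (t.1 (lo h)) (t.1 (hi h)) • c s t +
          tabOff q (t.1 (hi h)) (t.1 (lo h)) • c s (t.swap h) := by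
      refine hinj ?_
      have e1 : f (c s t * τ) = f (c s t) * TM i := rfl
      rw [e1, map_add, map_smul, map_smul, hf _ _ hst, hf _ _ (hst.trans t.shape_swap.symm),
        hUT i h]
    exact congrArg (fun x : C => x.1.1) this
  · rw [← hfst, Subalgebra.map_toSubmodule]
    let g : C →ₗ[K] Module.End K W := LinearMap.fst K _ _ ∘ₗ C.val.toLinearMap
    have h1 : Submodule.map (AlgHom.fst K (Module.End K W) (Module.End K M)).toLinearMap
        (Subalgebra.toSubmodule C) = Submodule.map g ⊤ := by
      ext x
      simp [g]
    rw [h1, ← hspan, Submodule.map_span, ← Set.range_comp]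
    rfl
  · intro θ hθ s t hst
    have key : ∀ x ∈ C, θ ∘ₗ x.1 = x.2 ∘ₗ θ := by
      intro x hx
      induction hx using Algebra.adjoin_induction with
      | mem x hx => obtain ⟨i, hi, rfl⟩ := hx; exact hθ i hi
      | algebraMap a => ext w; simp [Algebra.algebraMap_eq_smul_one]
      | add x y _ _ hx hy => simp only [Prod.fst_add, Prod.snd_add, LinearMap.comp_add, hx, hy,
          LinearMap.add_comp]
      | mul x y _ _ hx hy =>
        simp only [Prod.fst_mul, Prod.snd_mul, Module.End.mul_eq_comp]
        rw [← LinearMap.comp_assoc, hx, LinearMap.comp_assoc, hy, LinearMap.comp_assoc]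
    rw [key _ (c s t).2, hc _ _ hst]

variable {q : K} (hq : q ≠ 0) (hq1 : ∀ k : ℤ, q ^ k = 1 → k = 0)
include hq hq1

/-- Any representation of the Hecke relations contains images of the matrix units of the seminormal
representation. -/
theorem exists_units {W : Type*} [AddCommGroup W] [Module K W] [FiniteDimensional K W]
    (hr : 1 ≤ r) (T : ℕ → Module.End K W) (hT : HeckeRel (q - q⁻¹) (r - 1) T) :
    ∃ e : SYT r → SYT r → Module.End K W,
      (∀ s t u v, s.shape = t.shape → u.shape = v.shape →
        e s t * e u v = if t = u then e s v else 0) ∧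
      (∀ s t, s.shape = t.shape → ∀ (i : ℕ) (h : i + 1 < r),
        e s t * T i = tabDiag q (t.1 (lo h)) (t.1 (hi h)) • e s t +
          tabOff q (t.1 (hi h)) (t.1 (lo h)) • e s (t.swap h)) ∧
      Subalgebra.toSubmodule (Algebra.adjoin K (T '' Set.Iio (r - 1))) =
        Submodule.span K (Set.range fun p : SYTPair r => e p.1.1 p.1.2) ∧
      ∀ θ : W →ₗ[K] (SYT r →₀ K), (∀ i < r - 1, θ ∘ₗ T i = opM q r i ∘ₗ θ) →
        ∀ s t, s.shape = t.shape → θ ∘ₗ e s t = unitM K s t ∘ₗ θ := by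
  refine exists_units_aux hr T hT (opM q r) (opM_heckeRel hq hq1 r) (unitM K)
    (fun s t h => unitM_mem hq hq1 h) unitM_mul (fun s h => ?_) fun i h => unitM_mul_opM h
  have := LinearMap.congr_fun h (Finsupp.single s 1)
  rw [unitM_single, if_pos rfl] at this
  simp at this

end Units

section Vanishing

variable {r m n : ℕ}

lemma SYT.swap_apply_of_not_le {i : ℕ} {h : i + 1 < r} {t : SYT r}
    (hlo : ¬ t.1 (lo h) ≤ t.1 (hi h)) :
    (t.swap h).1 (lo h) = t.1 (hi h) ∧ (t.swap h).1 (hi h) = t.1 (lo h) ∧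
      ∀ k, k ≠ lo h → k ≠ hi h → (t.swap h).1 k = t.1 k := by
  rw [SYT.swap_val hlo]
  refine ⟨by simp, by simp, fun k h1 h2 => by simp [Equiv.swap_apply_of_ne_of_ne h1 h2]⟩

/-- Pigeonhole: a word in `m + n` letters which is sorted, in the sense that equal small letters
occupy distinct columns of a tableau and equal large ones distinct rows, keeps the tableau inside
the hook. -/
lemma not_mem_shape_of_sorted (u : SYT r) (a : Fin r → Fin (m + n))
    (hanti : ∀ i j, i ≤ j → a j ≤ a i)
    (hcol : ∀ i j, a i = a j → (a i : ℕ) < m → (u.1 i).2 = (u.1 j).2 → i = j)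
    (hrow : ∀ i j, a i = a j → m ≤ (a i : ℕ) → (u.1 i).1 = (u.1 j).1 → i = j) :
    (m, n) ∉ u.shape := by
  intro hmem
  have hmem' : ∀ x ≤ m, ∀ y ≤ n, ∃ k, u.1 k = (x, y) := fun x hx y hy =>
    SYT.mem_shape.1 (u.isLowerSet_shape (show ((x, y) : ℕ × ℕ) ≤ (m, n) from ⟨hx, hy⟩) hmem)
  have hsmall : ∀ x ≤ m, ∀ k, u.1 k = (x, n) → (a k : ℕ) < m := by
    intro x hx k hk
    by_contra hlt
    rw [not_lt] at hlt
    have h : ∀ y : Fin (n + 1), ∃ j ≤ k, u.1 j = (x, (y : ℕ)) := fun y =>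
      u.2.2 k _ (by rw [hk]; exact ⟨le_rfl, Nat.lt_succ_iff.1 y.2⟩)
    choose j hj hju using h
    have hbig : ∀ y, m ≤ (a (j y) : ℕ) := fun y => hlt.trans (hanti _ _ (hj y))
    obtain ⟨y, y', hne, he⟩ := Fintype.exists_ne_map_eq_of_card_lt
      (fun y => (⟨(a (j y) : ℕ) - m, by have := hbig y; have := (a (j y)).2; lia⟩ : Fin n))
      (by simp)
    have he' : a (j y) = a (j y') := by
      have h1 := hbig y; have h2 := hbig y'
      have h3 := congrArg Fin.val he
      simp only at h3
      exact Fin.ext (by lia)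
    have := hrow _ _ he' (hbig y) (by rw [hju, hju])
    have h5 := congrArg u.1 this
    rw [hju, hju, Prod.mk.injEq] at h5
    exact hne (Fin.ext h5.2)
  choose k hk using fun x : Fin (m + 1) => hmem' x (Nat.lt_succ_iff.1 x.2) n le_rfl
  have hlt : ∀ x, (a (k x) : ℕ) < m := fun x => hsmall x (Nat.lt_succ_iff.1 x.2) _ (hk x)
  obtain ⟨x, x', hne, he⟩ := Fintype.exists_ne_map_eq_of_card_lt
    (fun x => (⟨(a (k x) : ℕ), hlt x⟩ : Fin m)) (by simp)
  have := hcol _ _ (Fin.ext (congrArg Fin.val he :)) (hlt x) (by rw [hk, hk])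
  have h5 := congrArg u.1 this
  rw [hk, hk, Prod.mk.injEq] at h5
  exact hne (Fin.ext h5.1)

variable {K : Type*} [Field K] {q : K} (hq : q ≠ 0) (hq1 : ∀ k : ℤ, q ^ k = 1 → k = 0)
include hq hq1

lemma add_inv_ne : q + q⁻¹ ≠ 0 := fun h => by
  have h1 : q * q = -1 := by
    have := mul_inv_cancel₀ hq
    linear_combination q * h - this
  have := hq1 4 (by
    rw [show q ^ (4 : ℤ) = q ^ 4 from zpow_ofNat q 4]
    linear_combination (q * q - 1) * h1)
  simp at this

/-- The eigenvalue equation for `T_i` forces the tableau to increase along rows or columns. -/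
lemma incr_of_eigen {W : Type*} [AddCommGroup W] [Module K W] {x : SYT r → W} {i : ℕ}
    (h : i + 1 < r) {u : SYT r} {ε : K} (hx : x u ≠ 0)
    (heq : ε • x u = tabDiag q (u.1 (lo h)) (u.1 (hi h)) • x u +
      tabOff q (u.1 (hi h)) (u.1 (lo h)) • x (u.swap h)) :
    (ε = q → (u.1 (lo h)).2 < (u.1 (hi h)).2 ∨
      (¬ u.1 (lo h) ≤ u.1 (hi h) ∧ (u.1 (hi h)).2 < (u.1 (lo h)).2 ∧ x (u.swap h) ≠ 0)) ∧
    (ε = -q⁻¹ → (u.1 (lo h)).1 < (u.1 (hi h)).1 ∨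
      (¬ u.1 (lo h) ≤ u.1 (hi h) ∧ (u.1 (hi h)).1 < (u.1 (lo h)).1 ∧ x (u.swap h) ≠ 0)) := by
  have hne := u.content_lo_ne h
  by_cases hlo : u.1 (lo h) ≤ u.1 (hi h)
  · rw [tabOff_comm_of_le hlo, zero_smul, add_zero] at heq
    have hε := smul_left_injective K hx heq
    have h2 := add_inv_ne hq hq1
    rcases (u.2.le_iff h).1 hlo with hc | hc
    · rw [tabDiag_right hq hq1 hc] at hε
      have := u.2.hi_eq_right h hc
      refine ⟨fun _ => Or.inl ?_, fun h' => (h2 ?_).elim⟩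
      · rw [this]; simp
      · linear_combination hε.symm.trans h'
    · rw [tabDiag_below hq hq1 hc] at hε
      have := u.2.hi_eq_below h hc
      refine ⟨fun h' => (h2 ?_).elim, fun _ => Or.inl ?_⟩
      · linear_combination h'.symm.trans hε
      · rw [this]; simp
  · have hcomp := u.2.not_hi_lt_lo h
    rw [Prod.le_def] at hlo
    rw [Prod.lt_iff] at hcomp
    have hx' : ε ^ 2 = (q - q⁻¹) * ε + 1 → x (u.swap h) ≠ 0 := by
      intro hε h0
      rw [h0, smul_zero, add_zero] at heq
      have hD := smul_left_injective K hx heq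
      have hmul := tabOff_mul hq hq1 hne
      rw [← hD] at hmul
      have hz : tabOff q (u.1 (lo h)) (u.1 (hi h)) * tabOff q (u.1 (hi h)) (u.1 (lo h)) = 0 := by
        rw [hmul]; linear_combination -hε
      have hno : ¬ (content (u.1 (hi h)) = content (u.1 (lo h)) + 1 ∨
          content (u.1 (lo h)) = content (u.1 (hi h)) + 1) := by
        rw [← u.2.le_iff h, Prod.le_def]; exact hlo
      exact mul_ne_zero ((tabOff_ne_zero_iff hq hq1 hne).2 hno)
        ((tabOff_ne_zero_iff hq hq1 hne.symm).2 fun h' => hno h'.symm) hz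
    have hqq := mul_inv_cancel₀ hq
    refine ⟨fun hε => ?_, fun hε => ?_⟩
    · have := hx' (by rw [hε]; linear_combination hqq)
      rw [Prod.le_def]
      by_cases h1 : (u.1 (lo h)).2 < (u.1 (hi h)).2
      · exact Or.inl h1
      · exact Or.inr ⟨hlo, by lia, this⟩
    · have := hx' (by rw [hε]; linear_combination hqq)
      rw [Prod.le_def]
      by_cases h1 : (u.1 (lo h)).1 < (u.1 (hi h)).1
      · exact Or.inl h1
      · exact Or.inr ⟨hlo, by lia, this⟩

omit hq hq1 in
lemma rel_key (a : Fin r → Fin (m + n)) (g : Fin r → ℕ)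
    (hanti : ∀ (i : ℕ) (h : i + 1 < r), a (hi h) ≤ a (lo h))
    (hg : ∀ (i : ℕ) (h : i + 1 < r), a (lo h) = a (hi h) → g (lo h) < g (hi h)) {i j : Fin r}
    (hij : i < j) : a j < a i ∨ a j = a i ∧ g i < g j := by
  let R : Fin (m + n) × ℕ → Fin (m + n) × ℕ → Prop := fun p p' =>
    p'.1 < p.1 ∨ p'.1 = p.1 ∧ p.2 < p'.2
  have : IsTrans _ R := ⟨by
    rintro ⟨a, b⟩ ⟨c, d⟩ ⟨e, f⟩ h1 h2
    simp only [R] at *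
    lia⟩
  refine rel_of_adjacent (R := R) (f := fun k => (a k, g k)) (fun i h => ?_) hij
  by_cases h' : a (lo h) = a (hi h)
  · exact Or.inr ⟨h'.symm, hg i h h'⟩
  · exact Or.inl (lt_of_le_of_ne (hanti i h) (Ne.symm h'))

/-- The matrix units attached to a diagram outside the hook vanish on tensor space. -/
theorem units_eq_zero {s : SYT r} (hs : (m, n) ∈ s.shape)
    {e : SYT r → Module.End K ((Fin r → Fin (m + n)) → K)}
    (he : ∀ t, s.shape = t.shape → ∀ (i : ℕ) (h : i + 1 < r),
        e t * opW q m (m + n) r i = tabDiag q (t.1 (lo h)) (t.1 (hi h)) • e t +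
          tabOff q (t.1 (hi h)) (t.1 (lo h)) • e (t.swap h)) : e s = 0 := by
  classical
  by_contra hes
  let v : (Fin r → Fin (m + n)) → ((Fin r → Fin (m + n)) → K) := fun a => Pi.single a 1
  let A : Set (Fin r → Fin (m + n)) := {a | ∃ t, s.shape = t.shape ∧ e t (v a) ≠ 0}
  have hA : A.Nonempty := by
    by_contra hA
    refine hes (LinearMap.pi_ext' fun a => LinearMap.ext_ring ?_)
    by_contra h
    exact hA ⟨a, s, rfl, h⟩
  obtain ⟨a, ⟨t₀, ht₀, hat₀⟩, hmin⟩ := Set.exists_min_image A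
    (fun a => potential fun k => ((a k : ℕ) : ℤ)) (Set.toFinite _) hA
  have hstep : ∀ t, s.shape = t.shape → ∀ (i : ℕ) (h : i + 1 < r) (b : Fin r → Fin (m + n)),
      wordDiag q m (b (lo h)) (b (hi h)) • e t (v b) +
        wordOff K m (b (lo h)) (b (hi h)) • e t (v (swapAt h b)) =
      tabDiag q (t.1 (lo h)) (t.1 (hi h)) • e t (v b) +
        tabOff q (t.1 (hi h)) (t.1 (lo h)) • e (t.swap h) (v b) := by
    intro t ht i h b
    have := LinearMap.congr_fun (he t ht i h) (v b)
    simpa only [Module.End.mul_apply, v, opW_single q m i h, map_add, map_smul,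
      LinearMap.add_apply, LinearMap.smul_apply] using this
  have hanti : ∀ (i : ℕ) (h : i + 1 < r), a (hi h) ≤ a (lo h) := by
    intro i h
    by_contra hlt
    rw [not_le] at hlt
    have hzero : ∀ t, s.shape = t.shape → e t (v (swapAt h a)) = 0 := by
      intro t ht
      by_contra hne
      have := hmin _ ⟨t, ht, hne⟩
      have e2 : (fun k => (((swapAt h a k : Fin (m + n)) : ℕ) : ℤ)) =
        swapAt h fun k => ((a k : ℕ) : ℤ) := rfl
      rw [e2, potential_swapAt] at this
      rw [Fin.lt_def] at hlt
      lia
    have := hstep t₀ ht₀ i h (swapAt h a)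
    have e3 : swapAt h (swapAt h a) = a := by funext k; simp
    rw [hzero t₀ ht₀, hzero _ (ht₀.trans t₀.shape_swap.symm), e3] at this
    simp only [smul_zero, zero_add, Function.comp_apply, Equiv.swap_apply_left,
      Equiv.swap_apply_right, add_zero] at this
    refine hat₀ ((smul_eq_zero.1 this).resolve_left ?_)
    rw [wordOff, if_neg hlt.ne']
    exact left_ne_zero_of_mul_eq_one (sgn_mul_self (K := K) m _ _)
  let g : SYT r → Fin r → ℕ := fun t k => if (a k : ℕ) < m then (t.1 k).2 else (t.1 k).1
  obtain ⟨t, ⟨ht, hat⟩, hmax⟩ := Set.exists_max_image {t | s.shape = t.shape ∧ e t (v a) ≠ 0}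
    (fun t => potential fun k => (g t k : ℤ)) (Set.toFinite _) ⟨t₀, ht₀, hat₀⟩
  have hg : ∀ (i : ℕ) (h : i + 1 < r), a (lo h) = a (hi h) → g t (lo h) < g t (hi h) := by
    intro i h hai
    have heq := hstep t ht i h a
    rw [wordOff, if_pos hai, zero_smul, add_zero] at heq
    have hinc := incr_of_eigen hq hq1 (x := fun t => e t (v a)) h hat heq
    have hcontra : ¬ (¬ t.1 (lo h) ≤ t.1 (hi h) ∧ g t (hi h) < g t (lo h) ∧
        e (t.swap h) (v a) ≠ 0) := by
      rintro ⟨hlo, hlt, hne⟩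
      have h1 := hmax _ ⟨ht.trans t.shape_swap.symm, hne⟩
      obtain ⟨s1, s2, s3⟩ := SYT.swap_apply_of_not_le hlo
      have e2 : (fun k => (g (t.swap h) k : ℤ)) = swapAt h fun k => (g t k : ℤ) := by
        funext k
        simp only [Function.comp_apply, g]
        by_cases hk : k = lo h
        · rw [hk, Equiv.swap_apply_left, s1, hai]
        · by_cases hk' : k = hi h
          · rw [hk', Equiv.swap_apply_right, s2, hai]
          · rw [Equiv.swap_apply_of_ne_of_ne hk hk', s3 k hk hk']
      rw [e2, potential_swapAt] at h1
      lia
    simp only [wordDiag, hai, if_true] at hinc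
    by_cases hm : (a (hi h) : ℕ) < m
    · simp only [g, hai, if_pos hm] at hcontra hinc ⊢
      exact (hinc.1 trivial).resolve_right hcontra
    · simp only [g, hai, if_neg hm] at hcontra hinc ⊢
      exact (hinc.2 trivial).resolve_right hcontra
  have hkey := fun (i j : Fin r) (hij : i < j) => rel_key a (g t) hanti hg hij
  have hginj : ∀ i j, a i = a j → g t i = g t j → i = j := by
    intro i j h1 h2
    rcases lt_trichotomy i j with h | h | h
    · have := hkey i j h; lia
    · exact h
    · have := hkey j i h; lia
  refine not_mem_shape_of_sorted t a (fun i j hij => ?_) (fun i j h1 h2 h3 => ?_)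
    (fun i j h1 h2 h3 => ?_) (ht ▸ hs)
  · rcases hij.lt_or_eq with h | h
    · have := hkey i j h; lia
    · rw [h]
  · exact hginj i j h1 (by simp only [g, ← h1, if_pos h2, h3])
  · exact hginj i j h1 (by simp only [g, ← h1, if_neg h2.not_gt, h3])

end Vanishing

section Intertwiner

variable {r N : ℕ} {Y : Type*}

lemma swapAt_swapAt {i : ℕ} (h : i + 1 < r) (a : Fin r → Y) : swapAt h (swapAt h a) = a := by
  funext k; simp

lemma swapAt_comm {i j : ℕ} (h : i + 1 < r) (h' : j + 1 < r) (hij : i + 1 < j) (a : Fin r → Y) :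
    swapAt h (swapAt h' a) = swapAt h' (swapAt h a) := by
  funext k
  simp only [Function.comp_apply, Equiv.swap_apply_def]
  congr 1
  grind

lemma swapAt_braid {i : ℕ} (h : i + 1 < r) (h' : i + 1 + 1 < r) (a : Fin r → Y) :
    swapAt h (swapAt h' (swapAt h a)) = swapAt h' (swapAt h (swapAt h' a)) := by
  funext k
  simp only [Function.comp_apply, Equiv.swap_apply_def]
  congr 1
  grind

lemma swapAt_lo {i : ℕ} (h : i + 1 < r) (a : Fin r → Y) : swapAt h a (lo h) = a (hi h) := by simp

lemma swapAt_hi {i : ℕ} (h : i + 1 < r) (a : Fin r → Y) : swapAt h a (hi h) = a (lo h) := by simp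

lemma swapAt_of_ne {i : ℕ} (h : i + 1 < r) (a : Fin r → Y) {k : Fin r} (h1 : (k : ℕ) ≠ i)
    (h2 : (k : ℕ) ≠ i + 1) : swapAt h a k = a k := by
  rw [swapAt, Function.comp_apply, Equiv.swap_apply_of_ne_of_ne]
  · exact fun h => h1 (congrArg Fin.val h)
  · exact fun h => h2 (congrArg Fin.val h)

lemma potential_swapAt_lt {i : ℕ} (h : i + 1 < r) {a : Fin r → Fin N} (hlt : a (lo h) < a (hi h)) :
    potential (fun k => ((swapAt h a k : Fin N) : ℤ)) < potential fun k => ((a k : ℕ) : ℤ) := by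
  have e : (fun k => ((swapAt h a k : Fin N) : ℤ)) = swapAt h fun k => ((a k : ℕ) : ℤ) := rfl
  rw [e, potential_swapAt]
  rw [Fin.lt_def] at hlt
  lia

lemma toNat_potential_lt {i : ℕ} (h : i + 1 < r) {a : Fin r → Fin N}
    (hlt : a (lo h) < a (hi h)) :
    (potential fun k => ((swapAt h a k : Fin N) : ℤ)).toNat <
      (potential fun k => ((a k : ℕ) : ℤ)).toNat := by
  have h1 := potential_swapAt_lt h hlt
  have h2 : 0 ≤ potential fun k => ((swapAt h a k : Fin N) : ℤ) :=
    Finset.sum_nonneg fun k _ => by positivity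
  lia

variable {K : Type*} [Field K] {q : K} {m : ℕ} {M : Type*} [AddCommGroup M] [Module K M]

/-- The image of a word under the intertwiner that is determined by the image `y` of the word
`a₀`: sort the word, recording the operators that are used. -/
noncomputable def wordVec (m : ℕ) (T : ℕ → Module.End K M) (a₀ : Fin r → Fin N) (y : M)
    (a : Fin r → Fin N) : M := by
  classical
  exact
    if h : ∃ i, ∃ h : i + 1 < r, a (lo h) < a (hi h) then
      sgn K m (a (lo h.choose_spec.choose)) (a (hi h.choose_spec.choose)) •
        T h.choose (wordVec m T a₀ y (swapAt h.choose_spec.choose a))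
    else if a = a₀ then y else 0
termination_by (potential fun k => ((a k : ℕ) : ℤ)).toNat
decreasing_by exact toNat_potential_lt _ h.choose_spec.choose_spec

lemma wordVec_ascent (T : ℕ → Module.End K M) (a₀ : Fin r → Fin N) (y : M)
    {a : Fin r → Fin N} (h : ∃ i, ∃ h : i + 1 < r, a (lo h) < a (hi h)) :
    ∃ i, ∃ h : i + 1 < r, a (lo h) < a (hi h) ∧ wordVec m T a₀ y a =
      sgn K m (a (lo h)) (a (hi h)) • T i (wordVec m T a₀ y (swapAt h a)) := by
  refine ⟨_, _, h.choose_spec.choose_spec, ?_⟩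
  conv_lhs => rw [wordVec]
  rw [dif_pos h]

lemma wordVec_sorted (T : ℕ → Module.End K M) (a₀ : Fin r → Fin N) (y : M)
    {a : Fin r → Fin N} (h : ¬ ∃ i, ∃ h : i + 1 < r, a (lo h) < a (hi h)) [Decidable (a = a₀)] :
    wordVec m T a₀ y a = if a = a₀ then y else 0 := by
  rw [wordVec, dif_neg h]
  congr

variable {T : ℕ → Module.End K M} (hT : HeckeRel (q - q⁻¹) (r - 1) T) {a₀ : Fin r → Fin N} {y : M}
  (hy : ∀ (i : ℕ) (h : i + 1 < r), a₀ (lo h) = a₀ (hi h) →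
    T i y = wordDiag q m (a₀ (lo h)) (a₀ (lo h)) • y)

include hT in
lemma smul_sgn_sgn_comm {i j : ℕ} (h : i + 1 < r) (h' : j + 1 < r) (hij : i + 1 < j) (w : M)
    (x x' : K) : x • T i (x' • T j w) = x' • T j (x • T i w) := by
  have := LinearMap.congr_fun (hT.comm i j hij (by lia)) w
  simp only [Module.End.mul_apply] at this
  rw [map_smul, map_smul, this, smul_comm]

include hT in
lemma smul_braid {i : ℕ} (h' : i + 1 + 1 < r) (w : M) (x x' x'' : K) :
    x • T i (x' • T (i + 1) (x'' • T i w)) = x'' • T (i + 1) (x' • T i (x • T (i + 1) w)) := by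
  have := LinearMap.congr_fun (hT.braid i (by lia)) w
  simp only [Module.End.mul_apply] at this
  simp only [map_smul, this]
  module

include hT hy in
lemma wordVec_spec (a : Fin r → Fin N) : ∀ (i : ℕ) (h : i + 1 < r),
    (a (lo h) < a (hi h) → wordVec m T a₀ y a =
      sgn K m (a (lo h)) (a (hi h)) • T i (wordVec m T a₀ y (swapAt h a))) ∧
    (a (lo h) = a (hi h) → T i (wordVec m T a₀ y a) =
      wordDiag q m (a (lo h)) (a (lo h)) • wordVec m T a₀ y a) := by
  classical
  induction hn : (potential fun k => ((a k : ℕ) : ℤ)).toNat using Nat.strong_induction_on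
    generalizing a with
  | _ n ih =>
    subst hn
    by_cases hasc : ∃ i, ∃ h : i + 1 < r, a (lo h) < a (hi h)
    · obtain ⟨i, h, hlt, hx⟩ := wordVec_ascent (m := m) T a₀ y hasc
      set x := wordVec m T a₀ y with hxdef
      have hP := fun {k : ℕ} (hk : k + 1 < r) (b : Fin r → Fin N)
        (hb : b (lo hk) < b (hi hk)) (hba : (potential fun k => ((b k : ℕ) : ℤ)).toNat ≤
          (potential fun k => ((a k : ℕ) : ℤ)).toNat) =>
        ih _ (lt_of_lt_of_le (toNat_potential_lt hk hb) hba) (swapAt hk b) rfl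
      have hle := fun {k : ℕ} (hk : k + 1 < r) (b : Fin r → Fin N)
        (hb : b (lo hk) < b (hi hk)) => (toNat_potential_lt hk hb).le
      -- consistency of two ascents
      have far : ∀ {i j : ℕ} (h : i + 1 < r) (h' : j + 1 < r), i + 1 < j →
          a (lo h) < a (hi h) → a (lo h') < a (hi h') →
          sgn K m (a (lo h)) (a (hi h)) • T i (x (swapAt h a)) =
            sgn K m (a (lo h')) (a (hi h')) • T j (x (swapAt h' a)) := by
        intro i j h h' hij h1 h2
        have e1 := (hP h a h1 le_rfl j h').1
        have e2 := (hP h' a h2 le_rfl i h).1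
        rw [swapAt_of_ne h a (by simp; lia) (by simp; lia),
          swapAt_of_ne h a (by simp; lia) (by simp; lia)] at e1
        rw [swapAt_of_ne h' a (by simp; lia) (by simp; lia),
          swapAt_of_ne h' a (by simp; lia) (by simp; lia)] at e2
        rw [e1 h2, e2 h1, smul_sgn_sgn_comm hT h h' hij, swapAt_comm h h' hij]
      have near : ∀ {i : ℕ} (h : i + 1 < r) (h' : i + 1 + 1 < r),
          a (lo h) < a (hi h) → a (lo h') < a (hi h') →
          sgn K m (a (lo h)) (a (hi h)) • T i (x (swapAt h a)) =
            sgn K m (a (lo h')) (a (hi h')) • T (i + 1) (x (swapAt h' a)) := by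
        intro i h h' h1 h2
        have h2' : a (hi h) < a (hi h') := h2
        have v1 : swapAt h a (lo h') = a (lo h) := swapAt_hi h a
        have v2 : swapAt h a (hi h') = a (hi h') :=
          swapAt_of_ne h a (by dsimp only; lia) (by dsimp only; lia)
        have v3 : swapAt h' a (lo h) = a (lo h) :=
          swapAt_of_ne h' a (by dsimp only; lia) (by dsimp only; lia)
        have v4 : swapAt h' a (hi h) = a (hi h') := swapAt_lo h' a
        have w1 : swapAt h' (swapAt h a) (lo h) = a (hi h) := by
          rw [swapAt_of_ne h' _ (by dsimp only; lia) (by dsimp only; lia), swapAt_lo]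
        have w2 : swapAt h' (swapAt h a) (hi h) = a (hi h') := (swapAt_lo h' _).trans v2
        have w3 : swapAt h (swapAt h' a) (lo h') = a (lo h) := (swapAt_hi h _).trans v3
        have w4 : swapAt h (swapAt h' a) (hi h') = a (hi h) := by
          rw [swapAt_of_ne h _ (by dsimp only; lia) (by dsimp only; lia), swapAt_hi]
        have o1 : swapAt h a (lo h') < swapAt h a (hi h') := by rw [v1, v2]; exact h1.trans h2'
        have o2 : swapAt h' a (lo h) < swapAt h' a (hi h) := by rw [v3, v4]; exact h1.trans h2'
        have e1 := (hP h a h1 le_rfl (i + 1) h').1 o1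
        have e2 := (hP h' a h2 le_rfl i h).1 o2
        have e3 := (hP h' _ o1 (hle h a h1) i h).1 (by rw [w1, w2]; exact h2')
        have e4 := (hP h _ o2 (hle h' a h2) (i + 1) h').1 (by rw [w3, w4]; exact h1)
        rw [v1, v2] at e1
        rw [v3, v4] at e2
        rw [w1, w2] at e3
        rw [w3, w4] at e4
        rw [e1, e2, e3, e4, smul_braid hT h', swapAt_braid h h']
      intro j h'
      refine ⟨fun hlt' => ?_, fun heq => ?_⟩
      · rw [hx]
        rcases lt_trichotomy i j with hij | rfl | hij
        · rcases (Nat.succ_le_of_lt hij).lt_or_eq with hij | rfl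
          · exact far h h' hij hlt hlt'
          · exact near h h' hlt hlt'
        · rfl
        · rcases (Nat.succ_le_of_lt hij).lt_or_eq with hij | rfl
          · exact (far h' h hij hlt' hlt).symm
          · exact (near h' h hlt' hlt).symm
      · have hcomm : (i + 1 < j ∨ j + 1 < i) →
          T j (x a) = wordDiag q m (a (lo h')) (a (lo h')) • x a := by
          intro hij
          have e1 := (hP h a hlt le_rfl j h').2
          rw [swapAt_of_ne h a (by simp; lia) (by simp; lia),
            swapAt_of_ne h a (by simp; lia) (by simp; lia)] at e1
          have hc : T j (T i (x (swapAt h a))) = T i (T j (x (swapAt h a))) := by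
            rcases hij with hij | hij
            · exact (LinearMap.congr_fun (hT.comm i j hij (by lia)) _).symm
            · exact LinearMap.congr_fun (hT.comm j i hij (by lia)) _
          rw [hx, map_smul, hc, e1 heq, map_smul, smul_comm]
        rcases lt_trichotomy i j with hij | rfl | hij
        · rcases (Nat.succ_le_of_lt hij).lt_or_eq with hij | rfl
          · exact hcomm (Or.inl hij)
          · have heq' : a (hi h) = a (hi h') := heq
            have v1 : swapAt h a (lo h') = a (lo h) := swapAt_hi h a
            have v2 : swapAt h a (hi h') = a (hi h') :=
              swapAt_of_ne h a (by dsimp only; lia) (by dsimp only; lia)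
            have w1 : swapAt h' (swapAt h a) (lo h) = a (hi h) := by
              rw [swapAt_of_ne h' _ (by dsimp only; lia) (by dsimp only; lia), swapAt_lo]
            have w2 : swapAt h' (swapAt h a) (hi h) = a (hi h') := (swapAt_lo h' _).trans v2
            have o1 : swapAt h a (lo h') < swapAt h a (hi h') := by
              rw [v1, v2, ← heq']; exact hlt
            have e1 := (hP h a hlt le_rfl (i + 1) h').1 o1
            have e2 := (hP h' _ o1 (hle h a hlt) i h).2 (by rw [w1, w2, heq'])
            have hb := LinearMap.congr_fun (hT.braid i (by lia)) (x (swapAt h' (swapAt h a)))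
            simp only [Module.End.mul_apply] at hb
            rw [v1, v2] at e1
            rw [w1] at e2
            rw [hx, e1]
            simp only [map_smul]
            rw [← hb, e2]
            simp only [map_smul]
            simp only [Nat.succ_eq_add_one]
            module
        · exact absurd heq hlt.ne
        · rcases (Nat.succ_le_of_lt hij).lt_or_eq with hij | rfl
          · exact hcomm (Or.inr hij)
          · have heq' : a (lo h') = a (lo h) := heq
            have v1 : swapAt h a (lo h') = a (lo h') :=
              swapAt_of_ne h a (by dsimp only; lia) (by dsimp only; lia)
            have v2 : swapAt h a (hi h') = a (hi h) := swapAt_lo h a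
            have w1 : swapAt h' (swapAt h a) (lo h) = a (lo h') := (swapAt_hi h' _).trans v1
            have w2 : swapAt h' (swapAt h a) (hi h) = a (lo h) := by
              rw [swapAt_of_ne h' _ (by dsimp only; lia) (by dsimp only; lia), swapAt_hi]
            have o1 : swapAt h a (lo h') < swapAt h a (hi h') := by
              rw [v1, v2, heq']; exact hlt
            have e1 := (hP h a hlt le_rfl j h').1 o1
            have e2 := (hP h' _ o1 (hle h a hlt) (j + 1) h).2 (by rw [w1, w2, heq'])
            have hb := LinearMap.congr_fun (hT.braid j (by lia)) (x (swapAt h' (swapAt h a)))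
            simp only [Module.End.mul_apply] at hb
            rw [v1, v2] at e1
            rw [w1] at e2
            rw [hx, e1]
            simp only [map_smul]
            rw [hb, e2]
            simp only [map_smul]
            simp only [Nat.succ_eq_add_one]
            module
    · intro i h
      refine ⟨fun h' => (hasc ⟨i, h, h'⟩).elim, fun heq => ?_⟩
      rw [wordVec_sorted T a₀ y hasc]
      split_ifs with ha
      · subst ha; exact hy i h heq
      · simp

include hT hy in
/-- A joint eigenvector for the operators fixing a sorted word `a₀` generates an image of the
permutation module of `a₀`. -/
theorem exists_intertwiner
    (ha₀ : ∀ (i : ℕ) (h : i + 1 < r), a₀ (hi h) ≤ a₀ (lo h)) :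
    ∃ θ : ((Fin r → Fin N) → K) →ₗ[K] M, θ (Pi.single a₀ 1) = y ∧
      ∀ i < r - 1, θ ∘ₗ opW q m N r i = T i ∘ₗ θ := by
  classical
  let x := wordVec (K := K) m T a₀ y
  let θ : ((Fin r → Fin N) → K) →ₗ[K] M := (Pi.basisFun K (Fin r → Fin N)).constr K x
  have hθ : ∀ a, θ (Pi.single a 1) = x a := fun a => by
    rw [← Pi.basisFun_apply]
    exact (Pi.basisFun K _).constr_basis K x a
  refine ⟨θ, ?_, fun i hi' => ?_⟩
  · rw [hθ]
    have : ¬ ∃ i, ∃ h : i + 1 < r, a₀ (lo h) < a₀ (hi h) := by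
      rintro ⟨i, h, hlt⟩
      exact (ha₀ i h).not_gt hlt
    exact (wordVec_sorted T a₀ y this).trans (if_pos rfl)
  · have h : i + 1 < r := by lia
    refine LinearMap.pi_ext' fun a => LinearMap.ext_ring ?_
    change θ (opW q m N r i (Pi.single a 1)) = T i (θ (Pi.single a 1))
    have e : ∀ b : Fin r → Fin N, b (lo h) < b (hi h) → T i (x b) =
        (q - q⁻¹) • x b + sgn K m (b (lo h)) (b (hi h)) • x (swapAt h b) := by
      intro b hb
      have h1 := (wordVec_spec hT hy b i h).1 hb
      have h2 := LinearMap.congr_fun (hT.quad i (by lia)) (x (swapAt h b))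
      simp only [Module.End.mul_apply, LinearMap.add_apply, LinearMap.smul_apply,
        Module.End.one_apply] at h2
      change x b = sgn K m (b (lo h)) (b (hi h)) • T i (x (swapAt h b)) at h1
      rw [h1, map_smul, h2]
      module
    rw [opW_single q m i h, map_add, map_smul, map_smul, hθ, hθ]
    change wordDiag q m (a (lo h)) (a (hi h)) • x a +
      wordOff K m (a (lo h)) (a (hi h)) • x (swapAt h a) = T i (x a)
    rcases lt_trichotomy (a (lo h)) (a (hi h)) with hlt | heq | hlt
    · rw [e a hlt, wordDiag, if_neg hlt.ne, if_pos hlt, wordOff, if_neg hlt.ne]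
    · rw [(wordVec_spec hT hy a i h).2 heq, ← heq]
      simp [wordOff, x]
    · have h1 := (wordVec_spec hT hy (swapAt h a) i h).1 (by
        rw [swapAt_lo, swapAt_hi]; exact hlt)
      rw [swapAt_swapAt, swapAt_lo, swapAt_hi] at h1
      change x (swapAt h a) = _ • T i (x a) at h1
      rw [h1, wordDiag, if_neg hlt.ne', if_neg hlt.not_gt, wordOff, if_neg hlt.ne', smul_smul,
        sgn_comm m (a (hi h)), sgn_mul_self]
      simp

end Intertwiner

section HookShapes

variable {r : ℕ} {K : Type*} [Field K] {q : K} (hq : q ≠ 0) (hq1 : ∀ k : ℤ, q ^ k = 1 → k = 0)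
  {m n : ℕ}

/-- The letter attached to a cell of the `(m,n)`-hook: the first `n` columns carry odd letters,
the remaining parts of the first `m` rows carry even letters. -/
def letter (m n : ℕ) (c : ℕ × ℕ) : ℕ := if c.2 < n then m + (n - 1 - c.2) else m - 1 - c.1

lemma SYT.lt_or_lt_of_not_mem {t : SYT r} (hs : (m, n) ∉ t.shape) (i : Fin r) :
    (t.1 i).2 < n ∨ (t.1 i).1 < m := by
  by_contra! h
  exact hs (t.isLowerSet_shape (show (m, n) ≤ t.1 i from ⟨h.2, h.1⟩) (mem_shape.2 ⟨i, rfl⟩))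

lemma letter_lt {t : SYT r} (hs : (m, n) ∉ t.shape) (i : Fin r) : letter m n (t.1 i) < m + n := by
  have := SYT.lt_or_lt_of_not_mem hs i
  rw [letter]
  split_ifs <;> lia

lemma letter_anti {c d : ℕ × ℕ} (h : c ≤ d) : letter m n d ≤ letter m n c := by
  obtain ⟨h1, h2⟩ := h
  rw [letter, letter]
  split_ifs <;> lia

lemma exists_sorted_letters (m n : ℕ) (s : SYT r) : ∃ t : SYT r, t.shape = s.shape ∧
    ∀ (i : ℕ) (h : i + 1 < r), letter m n (t.1 (hi h)) ≤ letter m n (t.1 (lo h)) := by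
  obtain ⟨t, ht, hmax⟩ := Set.exists_max_image {t : SYT r | t.shape = s.shape}
    (fun t => potential fun k => -(letter m n (t.1 k) : ℤ)) (Set.toFinite _) ⟨s, rfl⟩
  refine ⟨t, ht, fun i h => ?_⟩
  by_contra! hlt
  have hlo : ¬ t.1 (lo h) ≤ t.1 (hi h) := fun hle => (letter_anti hle).not_gt hlt
  have h1 := hmax (t.swap h) ((t.shape_swap).trans ht)
  have e : (fun k => -(letter m n ((t.swap h).1 k) : ℤ)) =
      swapAt h fun k => -(letter m n (t.1 k) : ℤ) := by
    rw [SYT.swap_val hlo]; rfl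
  simp only [e, potential_swapAt] at h1
  lia

include hq hq1 in
lemma opM_single_of_letter_eq {t : SYT r} (hs : (m, n) ∉ t.shape) {i : ℕ} (h : i + 1 < r)
    (heq : letter m n (t.1 (lo h)) = letter m n (t.1 (hi h))) :
    opM q r i (Finsupp.single t 1) =
      (if letter m n (t.1 (lo h)) < m then q else -q⁻¹) • Finsupp.single t (1 : K) := by
  have h1 := SYT.lt_or_lt_of_not_mem hs (lo h)
  have h2 := SYT.lt_or_lt_of_not_mem hs (hi h)
  have hnot := t.2.not_hi_lt_lo h
  have hcase : (t.1 (lo h)).2 = (t.1 (hi h)).2 ∧ ¬ letter m n (t.1 (lo h)) < m ∨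
      (t.1 (lo h)).1 = (t.1 (hi h)).1 ∧ letter m n (t.1 (lo h)) < m := by
    simp only [letter] at heq ⊢
    split_ifs at heq ⊢ <;> lia
  have hle : t.1 (lo h) ≤ t.1 (hi h) := by
    by_contra hle
    refine hnot (lt_of_le_of_ne ?_ (t.2.lo_ne_hi h).symm)
    rw [Prod.le_def] at hle ⊢
    lia
  rw [opM_single h t, tabOff_of_le hle, zero_smul, add_zero]
  rcases (t.2.le_iff h).1 hle with hc | hc
  · have := t.2.hi_eq_right h hc
    rw [tabDiag_right hq hq1 hc, if_pos]
    rw [this] at hcase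
    simpa using hcase
  · have := t.2.hi_eq_below h hc
    rw [tabDiag_below hq hq1 hc, if_neg]
    rw [this] at hcase
    simpa using hcase

include hq hq1 in
/-- The matrix units belonging to shapes inside the hook act nontrivially on tensor space. -/
theorem units_ne_zero {e : SYT r → SYT r → Module.End K ((Fin r → Fin (m + n)) → K)}
    (hmul : ∀ s t u v, s.shape = t.shape → u.shape = v.shape →
      e s t * e u v = if t = u then e s v else 0)
    (hθ : ∀ θ : ((Fin r → Fin (m + n)) → K) →ₗ[K] (SYT r →₀ K),
      (∀ i < r - 1, θ ∘ₗ opW q m (m + n) r i = opM q r i ∘ₗ θ) →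
        ∀ s t, s.shape = t.shape → θ ∘ₗ e s t = unitM K s t ∘ₗ θ)
    {s : SYT r} (hs : (m, n) ∉ s.shape) : e s s ≠ 0 := by
  intro hes
  obtain ⟨t, hts, hsorted⟩ := exists_sorted_letters m n s
  have ht : (m, n) ∉ t.shape := hts ▸ hs
  have hett : e t t = 0 := by
    have h1 := hmul t s s t hts hts.symm
    have h2 := hmul t s s s hts rfl
    rw [if_pos rfl] at h1 h2
    rw [hes, mul_zero] at h2
    rw [← h1, ← h2, zero_mul]
  let a₀ : Fin r → Fin (m + n) := fun i => ⟨letter m n (t.1 i), letter_lt ht i⟩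
  obtain ⟨θ, hθ₀, hθT⟩ := exists_intertwiner (q := q) (m := m) (a₀ := a₀)
    (y := Finsupp.single t (1 : K)) (opM_heckeRel hq hq1 r) (fun i h heq => by
      rw [opM_single_of_letter_eq hq hq1 ht h (congrArg Fin.val heq), wordDiag, if_pos rfl])
    (fun i h => Fin.le_def.2 (hsorted i h))
  have h := LinearMap.congr_fun (hθ θ hθT t t rfl) (Pi.single a₀ 1)
  rw [hett, LinearMap.comp_apply, LinearMap.comp_apply, hθ₀, unitM_single, if_pos rfl] at h
  rw [LinearMap.zero_apply, map_zero] at h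
  exact one_ne_zero (Finsupp.single_eq_zero.1 h.symm)

end HookShapes

section Dimension

variable {r : ℕ} {K : Type*} [Field K] {q : K} (hq : q ≠ 0) (hq1 : ∀ k : ℤ, q ^ k = 1 → k = 0)

include hq hq1 in
theorem finrank_adjoin_opW (m n : ℕ) (hr : 1 ≤ r) :
    Module.finrank K (Algebra.adjoin K (opW q m (m + n) r '' Set.Iio (r - 1))) =
      Nat.card {p : SYTPair r // (m, n) ∉ p.1.1.shape} := by
  classical
  obtain ⟨e, hmul, hT, hspan, hθ⟩ := exists_units hq hq1 hr _
    (opW_heckeRel (N := m + n) (r := r) m hq)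
  have hzero : ∀ s t : SYT r, s.shape = t.shape → (m, n) ∈ s.shape → e s t = 0 := by
    intro s t hst hs
    have h0 : e s s = 0 := units_eq_zero hq hq1 hs (e := e s) fun t ht i h => hT s t ht i h
    have := hmul s s s t rfl hst
    rw [if_pos rfl] at this
    rw [← this, h0, zero_mul]
  have hne : ∀ p : SYTPair r, (m, n) ∉ p.1.1.shape → e p.1.1 p.1.1 ≠ 0 := fun p hp =>
    units_ne_zero hq hq1 hmul hθ hp
  have hli := linearIndependent_units (K := K) hmul _ hne
  have hrange : Submodule.span K (Set.range fun p : SYTPair r => e p.1.1 p.1.2) =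
      Submodule.span K (Set.range fun p : {p : SYTPair r // (m, n) ∉ p.1.1.shape} =>
        e p.1.1.1 p.1.1.2) := by
    refine le_antisymm (Submodule.span_le.2 ?_) (Submodule.span_mono ?_)
    · rintro _ ⟨p, rfl⟩
      by_cases hp : (m, n) ∈ p.1.1.shape
      · simp only [hzero _ _ p.2 hp]
        exact zero_mem _
      · exact Submodule.subset_span ⟨⟨p, hp⟩, rfl⟩
    · rintro _ ⟨p, rfl⟩
      exact ⟨p.1, rfl⟩
  have hfin := finrank_span_eq_card hli
  rw [← hrange, ← hspan] at hfin
  rw [Nat.card_eq_fintype_card, ← hfin]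
  rfl

end Dimension

lemma q_ne_zero : _root_.q ≠ 0 := RatFunc.X_ne_zero

lemma q_zpow_eq_one (k : ℤ) (h : _root_.q ^ k = 1) : k = 0 := by
  have key : ∀ d : ℕ, _root_.q ^ d = 1 → d = 0 := by
    intro d hd
    have : (algebraMap (Polynomial ℚ) 𝕂) (Polynomial.X ^ d) = algebraMap (Polynomial ℚ) 𝕂 1 := by
      rw [map_pow, map_one, RatFunc.algebraMap_X]
      exact hd
    have := congrArg Polynomial.natDegree (RatFunc.algebraMap_injective ℚ this)
    simpa using this
  obtain ⟨d, rfl | rfl⟩ := k.eq_nat_or_neg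
  · exact_mod_cast key d (by simpa using h)
  · have := key d (by simpa using h)
    simp [this]

lemma image_heckeGens (m n r : ℕ) :
    Matrix.vecMulLinear '' heckeGens _root_.q _root_.q⁻¹ m (N := m + n) r =
      opW _root_.q m (m + n) r '' Set.Iio (r - 1) := by
  ext x
  constructor
  · rintro ⟨_, ⟨i, h, rfl⟩, rfl⟩
    exact ⟨i, by simp only [Set.mem_Iio]; lia, dif_pos h⟩
  · rintro ⟨i, hi', rfl⟩
    have h : i + 1 < r := by simp only [Set.mem_Iio] at hi'; lia
    exact ⟨_, ⟨i, h, rfl⟩, by rw [opW, dif_pos h]⟩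

section Shapes

variable {r : ℕ}

lemma card_filter_lt_succ (s : Multiset ℕ) (p : ℕ) :
    (s.filter fun x => p < x).card = (s.filter fun x => p + 1 < x).card + s.count (p + 1) := by
  induction s using Multiset.induction with
  | empty => simp
  | cons a s ih =>
    rw [Multiset.filter_cons, Multiset.filter_cons, Multiset.count_cons]
    split_ifs <;> simp <;> lia

lemma cellIn_injective {lam mu : Nat.Partition r} (h : ∀ c, cellIn lam c ↔ cellIn mu c) :
    lam = mu := by
  have hcard : ∀ p, (lam.parts.filter fun x => p < x).card =
      (mu.parts.filter fun x => p < x).card := by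
    intro p
    have h1 := h ((lam.parts.filter fun x => p < x).card, p)
    have h2 := h ((mu.parts.filter fun x => p < x).card, p)
    simp only [cellIn, lt_irrefl, false_iff, iff_false, not_lt] at h1 h2
    exact le_antisymm h2 h1
  refine Nat.Partition.ext (Multiset.ext.2 fun p => ?_)
  rcases p with _ | p
  · rw [Multiset.count_eq_zero_of_notMem fun h => (lam.parts_pos h).ne' rfl,
      Multiset.count_eq_zero_of_notMem fun h => (mu.parts_pos h).ne' rfl]
  · have h1 := card_filter_lt_succ lam.parts p
    have h2 := card_filter_lt_succ mu.parts p
    rw [hcard, hcard] at h1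
    lia

lemma cellIn_of_le {lam : Nat.Partition r} {c d : ℕ × ℕ} (h : c ≤ d) (hd : cellIn lam d) :
    cellIn lam c :=
  (h.1.trans_lt hd).trans_le (Multiset.card_le_card (Multiset.monotone_filter_right _
    fun _ hx => h.2.trans_lt hx))

lemma exists_partition_of_isLowerSet {D : Finset (ℕ × ℕ)} (hD : IsLowerSet (D : Set (ℕ × ℕ)))
    (hr : D.card = r) : ∃ lam : Nat.Partition r, ∀ c, c ∈ D ↔ cellIn lam c := by
  let μ : YoungDiagram := ⟨D, hD⟩
  have hlen : ∀ x, μ.rowLen x = (D.filter fun c => c.1 = x).card := fun x => μ.rowLen_eq_card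
  have hsum : ((Multiset.range r).map μ.rowLen).sum = r := by
    conv_rhs => rw [← hr]
    rw [Finset.card_eq_sum_card_fiberwise (f := Prod.fst) (t := Finset.range r)]
    · simp only [← hlen]
      rfl
    · intro c hc
      have := (lt_card_of_mem hD hc).1
      simpa [hr] using this
  refine ⟨Nat.Partition.ofSums r _ hsum, fun c => ?_⟩
  have h1 : (Finset.range r).filter (fun x => c.2 < μ.rowLen x) = Finset.range (μ.colLen c.2) := by
    ext x
    rw [Finset.mem_filter, Finset.mem_range, Finset.mem_range, ← YoungDiagram.mem_iff_lt_rowLen,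
      ← YoungDiagram.mem_iff_lt_colLen]
    exact and_iff_right_of_imp fun h => hr ▸ (lt_card_of_mem hD h).1
  have h2 : ((Nat.Partition.ofSums r _ hsum).parts.filter fun p => c.2 < p).card =
      μ.colLen c.2 := by
    rw [← Finset.card_range (μ.colLen c.2), ← h1, Nat.Partition.ofSums]
    simp only [Multiset.filter_filter]
    rw [Multiset.filter_congr (q := fun p => c.2 < p) (by intros; lia), Multiset.filter_map,
      Multiset.card_map]
    rfl
  rw [cellIn, h2, ← YoungDiagram.mem_iff_lt_colLen]
  rfl

lemma exists_shapePartition : ∃ Λ : SYT r → Nat.Partition r,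
    ∀ t lam, Λ t = lam ↔ ∀ c, c ∈ t.shape ↔ cellIn lam c := by
  choose Λ hΛ using fun t : SYT r => exists_partition_of_isLowerSet t.isLowerSet_shape t.card_shape
  refine ⟨Λ, fun t lam => ⟨?_, fun h => cellIn_injective fun c => (hΛ t c).symm.trans (h c)⟩⟩
  rintro rfl
  exact hΛ t

/-- A standard filling of a partition, read as the sequence of its cells. -/
lemma isStd_of_filling {lam : Nat.Partition r} {f : {c : ℕ × ℕ // cellIn lam c} → Fin r}
    (hf : Function.Bijective f)
    (hrow : ∀ c d : {c : ℕ × ℕ // cellIn lam c}, c.1.1 = d.1.1 → c.1.2 < d.1.2 → f c < f d)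
    (hcol : ∀ c d : {c : ℕ × ℕ // cellIn lam c}, c.1.2 = d.1.2 → c.1.1 < d.1.1 → f c < f d) :
    IsStd fun i => ((Equiv.ofBijective f hf).symm i).1 := by
  refine ⟨Subtype.val_injective.comp (Equiv.injective _), fun i c hc => ?_⟩
  set d := (Equiv.ofBijective f hf).symm i with hd
  have hfd : f d = i := Equiv.ofBijective_apply_symm_apply f hf i
  have hcell : cellIn lam (c.1, d.1.2) := cellIn_of_le (Prod.le_def.2 ⟨hc.1, le_rfl⟩) d.2
  refine ⟨f ⟨c, cellIn_of_le hc d.2⟩, ?_, by simp⟩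
  have h1 : f ⟨c, cellIn_of_le hc d.2⟩ ≤ f ⟨_, hcell⟩ := by
    rcases hc.2.lt_or_eq with h | h
    · exact (hrow ⟨c, cellIn_of_le hc d.2⟩ ⟨_, hcell⟩ rfl h).le
    · exact le_of_eq (congrArg f (Subtype.ext (Prod.ext rfl h)))
  have h2 : f ⟨_, hcell⟩ ≤ f d := by
    rcases hc.1.lt_or_eq with h | h
    · exact (hcol ⟨_, hcell⟩ d rfl h).le
    · exact le_of_eq (congrArg f (Subtype.ext (Prod.ext h rfl)))
  exact (h1.trans h2).trans_eq hfd

/-- `f^λ` counts the sequences of cells which are standard tableaux of shape `λ`. -/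
lemma fSYT_eq_card (lam : Nat.Partition r) :
    fSYT lam = Nat.card {t : SYT r // ∀ c, c ∈ t.shape ↔ cellIn lam c} := by
  let F : {f : {c : ℕ × ℕ // cellIn lam c} → Fin r //
      Function.Bijective f ∧
        (∀ c d : {c : ℕ × ℕ // cellIn lam c}, c.1.1 = d.1.1 → c.1.2 < d.1.2 → f c < f d) ∧
        (∀ c d : {c : ℕ × ℕ // cellIn lam c}, c.1.2 = d.1.2 → c.1.1 < d.1.1 → f c < f d)} →
      {t : SYT r // ∀ c, c ∈ t.shape ↔ cellIn lam c} := fun f =>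
    ⟨⟨_, isStd_of_filling f.2.1 f.2.2.1 f.2.2.2⟩, fun c => by
      refine SYT.mem_shape.trans ⟨?_, ?_⟩
      · rintro ⟨i, rfl⟩
        exact Subtype.prop _
      · exact fun hc => ⟨f.1 ⟨c, hc⟩, by simp⟩⟩
  refine Nat.card_eq_of_bijective F ⟨fun f g hfg => ?_, fun t => ?_⟩
  · refine Subtype.ext (funext fun c => ?_)
    have h : ∀ i, ((Equiv.ofBijective f.1 f.2.1).symm i).1 =
        ((Equiv.ofBijective g.1 g.2.1).symm i).1 :=
      congrFun (congrArg (fun t => t.1.1) hfg)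
    have := Subtype.ext (h (f.1 c))
    rw [Equiv.ofBijective_symm_apply_apply, Equiv.eq_symm_apply] at this
    exact this.symm
  · let b : Fin r → {c : ℕ × ℕ // cellIn lam c} := fun i =>
      ⟨t.1.1 i, (t.2 _).1 (SYT.mem_shape.2 ⟨i, rfl⟩)⟩
    have hb : Function.Bijective b := by
      refine ⟨fun i j h => t.1.2.1 (congrArg Subtype.val h), fun c => ?_⟩
      obtain ⟨i, hi'⟩ := SYT.mem_shape.1 ((t.2 c.1).2 c.2)
      exact ⟨i, Subtype.ext hi'⟩
    let B := Equiv.ofBijective b hb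
    have hB : ∀ c, t.1.1 (B.symm c) = c.1 := fun c =>
      congrArg Subtype.val (B.apply_symm_apply c)
    have hlt : ∀ c d : {c : ℕ × ℕ // cellIn lam c}, c.1 < d.1 → B.symm c < B.symm d :=
      fun c d h => t.1.2.lt_of_lt (by rwa [hB, hB])
    refine ⟨⟨B.symm, B.symm.bijective,
      fun c d h1 h2 => hlt c d (Prod.lt_iff.2 (Or.inr ⟨h1.le, h2⟩)),
      fun c d h1 h2 => hlt c d (Prod.lt_iff.2 (Or.inl ⟨h2, h1.le⟩))⟩, ?_⟩
    refine Subtype.ext (Subtype.ext (funext fun i => ?_))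
    have : (Equiv.ofBijective B.symm B.symm.bijective).symm i = B i := by
      rw [Equiv.symm_apply_eq]
      simp
    exact congrArg Subtype.val this

theorem card_hook_pairs (m n : ℕ) :
    Nat.card {p : SYTPair r // (m, n) ∉ p.1.1.shape} =
      ∑ lam ∈ hookFinset m n r, fSYT lam ^ 2 := by
  classical
  obtain ⟨Λ, hΛ⟩ := exists_shapePartition (r := r)
  have hf : ∀ lam : Nat.Partition r,
      fSYT lam = (Finset.univ.filter fun t : SYT r => Λ t = lam).card := by
    intro lam
    rw [fSYT_eq_card, Nat.card_eq_fintype_card, Fintype.card_subtype]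
    simp only [hΛ]
  have hΛs : ∀ s t : SYT r, Λ s = Λ t ↔ s.shape = t.shape := by
    intro s t
    rw [hΛ, Finset.ext_iff]
    exact forall_congr' fun c => by rw [((hΛ t _).1 rfl c)]
  have hhook : ∀ t : SYT r, (m, n) ∉ t.shape ↔ Λ t ∈ hookFinset m n r := by
    intro t
    rw [(hΛ t _).1 rfl, hookFinset, cellIn]
    simp
  let S : Finset (SYT r × SYT r) :=
    Finset.univ.filter fun p => p.1.shape = p.2.shape ∧ (m, n) ∉ p.1.shape
  have hS : Nat.card {p : SYTPair r // (m, n) ∉ p.1.1.shape} = S.card := by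
    rw [← Fintype.card_subtype, ← Nat.card_eq_fintype_card]
    exact Nat.card_congr (Equiv.subtypeSubtypeEquivSubtypeInter
      (fun p : SYT r × SYT r => p.1.shape = p.2.shape) fun p => (m, n) ∉ p.1.shape)
  rw [hS, Finset.card_eq_sum_card_fiberwise (f := fun p => Λ p.1) (t := hookFinset m n r)]
  · refine Finset.sum_congr rfl fun lam hlam => ?_
    rw [hf, sq, ← Finset.card_product]
    congr 1
    ext ⟨s, t⟩
    simp only [S, Finset.mem_filter, Finset.mem_univ, true_and, Finset.mem_product, hhook, ← hΛs]
    constructor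
    · rintro ⟨⟨h1, -⟩, h2⟩
      exact ⟨h2, h1 ▸ h2⟩
    · rintro ⟨rfl, h2⟩
      exact ⟨⟨h2.symm, hlam⟩, rfl⟩
  · intro p hp
    exact (hhook _).1 (Finset.mem_filter.1 hp).2.2

end Shapes

end HeckeHook

/-- hook decomposition of the Hecke algebra image. The `K`-dimension
of `𝒜_q` equals `Σ_{λ ∈ H(m,n;r)} (f^λ)²`. -/
theorem dim_Aq_eq_hook_sum (m n r : ℕ) (hm : 1 ≤ m) (hn : 1 ≤ n) (hr : 2 ≤ r) :
    Module.finrank 𝕂 (Aq m n r) = ∑ lam ∈ hookFinset m n r, fSYT lam ^ 2 := by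
  rw [← HeckeHook.card_hook_pairs, Aq, HeckeHook.image_heckeGens]
  exact HeckeHook.finrank_adjoin_opW HeckeHook.q_ne_zero HeckeHook.q_zpow_eq_one m n (by lia)
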